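/- arXiv:2301.02570 — 9 statements merged into one kernel-verified Lean document; each statement's English description precedes it below -/
import Mathlib

section
/- Let p be a prime, G a finite group, and N a normal subgroup of G. Then m_p(G) equals the maximum, taken over all elementary abelian p-subgroups A of G (the trivial subgroup included) satisfying A ∩ N = 1, of the quantity m_p(C_N(A)) + rank(A), where C_N(A) denotes the centralizer of A in N. -/
/-- A subgroup is an elementary abelian `p`-subgroup if it is isomorphic to `(ℤ/pℤ)^n`
for some `n ≥ 0`. -/
def IsElementaryAbelian (p : ℕ) {G : Type*} [Group G] (H : Subgroup G) : Prop :=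
  ∃ n : ℕ, Nonempty (H ≃* Multiplicative (Fin n → ZMod p))

/-- The `p`-rank of `G`: the largest `n` such that `G` has a subgroup
isomorphic to `(ℤ/pℤ)^n`. -/
noncomputable def pRank (p : ℕ) (G : Type*) [Group G] : ℕ :=
  sSup {n : ℕ | ∃ H : Subgroup G, Nonempty (H ≃* Multiplicative (Fin n → ZMod p))}

/-- The ranks of elementary abelian `p`-subgroups of a finite group are bounded. -/
theorem bddAbove_elementaryAbelian_ranks {p : ℕ} (hp : p.Prime) (G : Type*) [Group G] [Finite G] :
    BddAbove {n : ℕ | ∃ H : Subgroup G, Nonempty (H ≃* Multiplicative (Fin n → ZMod p))} := by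
  refine ⟨Nat.card G, ?_⟩
  rintro n ⟨H, ⟨e⟩⟩
  have hcard : Nat.card H = p ^ n := by
    rw [Nat.card_congr (e.toEquiv.trans Multiplicative.toAdd), Nat.card_fun, Nat.card_zmod,
      Nat.card_fin]
  exact (Nat.lt_pow_self hp.one_lt).le.trans (hcard ▸ Subgroup.card_le_card_group H)

theorem le_pRank_of_injective {p : ℕ} (hp : p.Prime) {G : Type*} [Group G] [Finite G] {n : ℕ}
    (f : Multiplicative (Fin n → ZMod p) →* G) (hf : Function.Injective f) : n ≤ pRank p G :=
  le_csSup (bddAbove_elementaryAbelian_ranks hp G) ⟨f.range, ⟨(MonoidHom.ofInjective hf).symm⟩⟩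

/-- The `p`-rank of a finite group is attained by an elementary abelian `p`-subgroup. -/
theorem exists_injective_pRank {p : ℕ} (hp : p.Prime) (G : Type*) [Group G] [Finite G] :
    ∃ f : Multiplicative (Fin (pRank p G) → ZMod p) →* G, Function.Injective f := by
  have hne : {n : ℕ | ∃ H : Subgroup G,
      Nonempty (H ≃* Multiplicative (Fin n → ZMod p))}.Nonempty :=
    ⟨0, ⊥, ⟨MulEquiv.ofUnique⟩⟩
  obtain ⟨H, ⟨e⟩⟩ := Nat.sSup_mem hne (bddAbove_elementaryAbelian_ranks hp G)
  exact ⟨H.subtype.comp e.symm.toMonoidHom, H.subtype_injective.comp e.symm.injective⟩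

theorem pRank_centralizer_add_le {p : ℕ} (hp : p.Prime) {G : Type*} [Group G] [Finite G]
    {N A : Subgroup G} {n : ℕ} (e : A ≃* Multiplicative (Fin n → ZMod p)) (hA : A ⊓ N = ⊥) :
    pRank p ↥(Subgroup.centralizer (A : Set G) ⊓ N) + n ≤ pRank p G := by
  obtain ⟨g, hg⟩ := exists_injective_pRank hp ↥(Subgroup.centralizer (A : Set G) ⊓ N)
  generalize pRank p ↥(Subgroup.centralizer (A : Set G) ⊓ N) = m at g hg ⊢
  let C := Subgroup.centralizer (A : Set G) ⊓ N
  let fst : Multiplicative (Fin (m + n) → ZMod p) →* C :=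
    g.comp (AddMonoidHom.toMultiplicative
      (LinearMap.funLeft (ZMod p) (ZMod p) (Fin.castAdd (m := n) (n := m))).toAddMonoidHom)
  let snd : Multiplicative (Fin (m + n) → ZMod p) →* A :=
    e.symm.toMonoidHom.comp (AddMonoidHom.toMultiplicative
      (LinearMap.funLeft (ZMod p) (ZMod p) (Fin.natAdd m)).toAddMonoidHom)
  have hcomm (x y) : Commute (C.subtype (fst x)) (A.subtype (snd y)) :=
    ((fst x).2.1 _ (snd y).2).symm
  let f : Multiplicative (Fin (m + n) → ZMod p) →* G :=
    { toFun x := C.subtype (fst x) * A.subtype (snd x)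
      map_one' := by simp
      map_mul' x y := by
        simp only [map_mul]
        exact (hcomm y x).symm.mul_mul_mul_comm _ _ |>.symm ▸ rfl }
  refine le_pRank_of_injective hp f ((injective_iff_map_eq_one f).2 fun x hx => ?_)
  replace hx : (fst x : G) * (snd x : G) = 1 := hx
  have hsnd : (snd x : G) = 1 := by
    rw [← Subgroup.mem_bot, ← hA]
    refine ⟨(snd x).2, ?_⟩
    rw [eq_inv_of_mul_eq_one_right hx]
    exact N.inv_mem (fst x).2.2
  have hfst : (fst x : G) = 1 := by simpa [hsnd] using hx
  have h1 := hg ((Subtype.ext hfst : fst x = 1).trans (map_one g).symm)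
  have h2 := e.symm.injective ((Subtype.ext hsnd : snd x = 1).trans (map_one e.symm).symm)
  refine Multiplicative.toAdd.injective (funext fun i => ?_)
  refine Fin.addCases (fun i => ?_) (fun i => ?_) i
  · exact congrFun (congrArg Multiplicative.toAdd h1) i
  · exact congrFun (congrArg Multiplicative.toAdd h2) i

theorem exists_pRank_le_pRank_centralizer_add {p : ℕ} (hp : p.Prime) {G : Type*} [Group G]
    [Finite G] (N : Subgroup G) :
    ∃ (A : Subgroup G) (n : ℕ), Nonempty (A ≃* Multiplicative (Fin n → ZMod p)) ∧ A ⊓ N = ⊥ ∧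
      pRank p G ≤ pRank p ↥(Subgroup.centralizer (A : Set G) ⊓ N) + n := by
  have : Fact p.Prime := ⟨hp⟩
  obtain ⟨f, hf⟩ := exists_injective_pRank hp G
  generalize pRank p G = r at f hf ⊢
  let W : Submodule (ZMod p) (Fin r → ZMod p) :=
    AddSubgroup.toZModSubmodule p (Subgroup.toAddSubgroup' (N.comap f))
  have memW (w) : w ∈ W ↔ f (Multiplicative.ofAdd w) ∈ N := Iff.rfl
  obtain ⟨U, hU⟩ := W.exists_isCompl
  let incl (S : Submodule (ZMod p) (Fin r → ZMod p)) :
      Multiplicative (Fin (Module.finrank (ZMod p) S) → ZMod p) →* G :=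
    f.comp (AddMonoidHom.toMultiplicative
      (S.subtype ∘ₗ (Module.finBasis (ZMod p) S).equivFun.symm.toLinearMap).toAddMonoidHom)
  have hincl (S) : Function.Injective (incl S) :=
    hf.comp (S.subtype_injective.comp (Module.finBasis (ZMod p) S).equivFun.symm.injective)
  have mem_incl (S) (x) : ∃ s ∈ S, f (Multiplicative.ofAdd s) = incl S x :=
    ⟨_, ((Module.finBasis (ZMod p) S).equivFun.symm (Multiplicative.toAdd x)).2, rfl⟩
  refine ⟨(incl U).range, _, ⟨(MonoidHom.ofInjective (hincl U)).symm⟩, ?_, ?_⟩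
  · rw [eq_bot_iff]
    rintro _ ⟨⟨x, rfl⟩, hx⟩
    obtain ⟨u, hu, hux⟩ := mem_incl U x
    have hu0 : u = 0 := Submodule.disjoint_def.1 hU.disjoint u ((memW u).2 (hux ▸ hx)) hu
    rw [← hux, hu0, Subgroup.mem_bot]
    exact map_one f
  · have hmem (x) : incl W x ∈ Subgroup.centralizer ((incl U).range : Set G) ⊓ N := by
      obtain ⟨w, hw, hwx⟩ := mem_incl W x
      rw [← hwx]
      refine ⟨?_, (memW w).1 hw⟩
      rintro _ ⟨y, rfl⟩
      obtain ⟨u, -, huy⟩ := mem_incl U y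
      rw [← huy, ← map_mul, mul_comm, map_mul]
    have hrank := le_pRank_of_injective hp ((incl W).codRestrict _ hmem)
      (fun x y h => hincl W (congrArg Subtype.val h))
    have hadd := Submodule.finrank_add_eq_of_isCompl hU
    rw [Module.finrank_fin_fun] at hadd
    omega

/-- For a finite group `G` with normal subgroup `N`, the `p`-rank of `G` is the maximum,
over all elementary abelian `p`-subgroups `A` (of rank `n`, the trivial subgroup included)
with `A ⊓ N = ⊥`, of `m_p(C_N(A)) + n`. -/
theorem pRank_eq_sSup_add_rank_centralizer (p : ℕ) (hp : p.Prime)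
    (G : Type*) [Group G] [Finite G] (N : Subgroup G) (hN : N.Normal) :
    pRank p G = sSup {m : ℕ | ∃ (A : Subgroup G) (n : ℕ),
      Nonempty (A ≃* Multiplicative (Fin n → ZMod p)) ∧ A ⊓ N = ⊥ ∧
      m = pRank p ↥(Subgroup.centralizer (A : Set G) ⊓ N) + n} := by
  refine le_antisymm ?_ ?_
  · obtain ⟨A, n, hA, hAN, hle⟩ := exists_pRank_le_pRank_centralizer_add hp N
    refine hle.trans (le_csSup ⟨pRank p G, ?_⟩ ⟨A, n, hA, hAN, rfl⟩)
    rintro _ ⟨A, n, ⟨e⟩, hAN, rfl⟩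
    exact pRank_centralizer_add_le hp e hAN
  · refine csSup_le' ?_
    rintro _ ⟨A, n, ⟨e⟩, hAN, rfl⟩
    exact pRank_centralizer_add_le hp e hAN
end

section
/- Let p be a prime, G a finite group, and N a normal subgroup of G. Then m_p(G) ≤ m_p(N) + m_p(G/N). -/
theorem bddAbove_setOf_elementaryAbelian (p : ℕ) [Fact p.Prime] (G : Type*) [Group G] [Finite G] :
    BddAbove {n : ℕ | ∃ H : Subgroup G, Nonempty (H ≃* Multiplicative (Fin n → ZMod p))} := by
  refine ⟨Nat.card G, ?_⟩
  rintro n ⟨H, ⟨e⟩⟩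
  have hcard : Nat.card H = p ^ n := by
    rw [Nat.card_congr (e.toEquiv.trans Multiplicative.toAdd)]
    simp
  calc n ≤ p ^ n := (Nat.lt_pow_self (Fact.out : p.Prime).one_lt).le
    _ = Nat.card H := hcard.symm
    _ ≤ Nat.card G := H.card_le_card_group

theorem finrank_le_pRank_of_injective (p : ℕ) [Fact p.Prime] {G : Type*} [Group G] [Finite G]
    {V : Type*} [AddCommGroup V] [Module (ZMod p) V] [FiniteDimensional (ZMod p) V]
    (f : Multiplicative V →* G) (hf : Function.Injective f) :
    Module.finrank (ZMod p) V ≤ pRank p G :=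
  le_csSup (bddAbove_setOf_elementaryAbelian p G) ⟨f.range, ⟨(MonoidHom.ofInjective hf).symm.trans
    (AddEquiv.toMultiplicative (Module.finBasis (ZMod p) V).equivFun.toAddEquiv)⟩⟩

/-- For a finite group `G` with a normal subgroup `N`,
`m_p(G) ≤ m_p(N) + m_p(G/N)`. -/
theorem pRank_le_pRank_add_pRank_quotient (p : ℕ) (hp : p.Prime)
    (G : Type*) [Group G] [Finite G] (N : Subgroup G) [N.Normal] :
    pRank p G ≤ pRank p N + pRank p (G ⧸ N) := by
  have : Fact p.Prime := ⟨hp⟩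
  refine csSup_le' ?_
  rintro n ⟨H, ⟨e⟩⟩
  let φ : Multiplicative (Fin n → ZMod p) →* G := H.subtype.comp e.symm.toMonoidHom
  have hφ : Function.Injective φ := H.subtype_injective.comp e.symm.injective
  let K : Submodule (ZMod p) (Fin n → ZMod p) := AddSubgroup.toZModSubmodule p
    { carrier := {v | φ (Multiplicative.ofAdd v) ∈ N}
      zero_mem' := by simp
      add_mem' := fun ha hb => by simpa using N.mul_mem ha hb
      neg_mem' := fun ha => by simpa using ha }
  have hK (v) : v ∈ K ↔ φ (Multiplicative.ofAdd v) ∈ N := Iff.rfl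
  obtain ⟨C, hC⟩ := K.exists_isCompl
  have hKN : Module.finrank (ZMod p) K ≤ pRank p N := by
    let f : Multiplicative K →* N := (φ.comp (AddMonoidHom.toMultiplicative
      K.subtype.toAddMonoidHom)).codRestrict N fun v => v.toAdd.2
    refine finrank_le_pRank_of_injective p f fun a b hab => ?_
    have hab' : φ (Multiplicative.ofAdd (a.toAdd : Fin n → ZMod p)) =
        φ (Multiplicative.ofAdd (b.toAdd : Fin n → ZMod p)) :=
      congrArg (fun x : N => (x : G)) hab
    exact Subtype.ext (hφ hab')
  have hCQ : Module.finrank (ZMod p) C ≤ pRank p (G ⧸ N) := by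
    let f : Multiplicative C →* G ⧸ N := ((QuotientGroup.mk' N).comp φ).comp
      (AddMonoidHom.toMultiplicative C.subtype.toAddMonoidHom)
    refine finrank_le_pRank_of_injective p f ((injective_iff_map_eq_one f).2 fun a ha => ?_)
    have haK : (a.toAdd : Fin n → ZMod p) ∈ K := (hK _).2 ((QuotientGroup.eq_one_iff _).1 ha)
    exact Subtype.ext (Submodule.disjoint_def.1 hC.disjoint _ haK a.toAdd.2)
  have hsum := Submodule.finrank_add_eq_of_isCompl hC
  rw [Module.finrank_fin_fun] at hsum
  omega
end

section
/- Let p be a prime, G a finite group, and N a central subgroup of G whose order is not divisible by p. Then the map sending a subgroup H of G to its image in G/N restricts to a bijection from the set of nontrivial elementary abelian p-subgroups of G onto the set of nontrivial elementary abelian p-subgroups of G/N, and this bijection preserves and reflects inclusion (i.e., it is an isomorphism of posets A_p(G) ≅ A_p(G/N)). -/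
theorem IsElementaryAbelian.pow_eq_one {p : ℕ} {G : Type*} [Group G] {H : Subgroup G}
    (hH : IsElementaryAbelian p H) {h : G} (hh : h ∈ H) : h ^ p = 1 := by
  obtain ⟨n, ⟨e⟩⟩ := hH
  have key : (⟨h, hh⟩ : H) ^ p = 1 := by
    apply e.injective
    rw [map_pow, map_one]
    apply Multiplicative.toAdd.injective
    funext i
    simp
  simpa using congrArg Subtype.val key

theorem IsElementaryAbelian.commute {p : ℕ} {G : Type*} [Group G] {H : Subgroup G}
    (hH : IsElementaryAbelian p H) {x y : G} (hx : x ∈ H) (hy : y ∈ H) : x * y = y * x := by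
  obtain ⟨n, ⟨e⟩⟩ := hH
  have key : (⟨x, hx⟩ : H) * ⟨y, hy⟩ = ⟨y, hy⟩ * ⟨x, hx⟩ := by
    apply e.injective
    rw [map_mul, map_mul, mul_comm]
  exact congrArg Subtype.val key

theorem IsElementaryAbelian.of_mulEquiv {p : ℕ} {G G' : Type*} [Group G] [Group G']
    {H : Subgroup G} {K : Subgroup G'} (hH : IsElementaryAbelian p H) (e : H ≃* K) :
    IsElementaryAbelian p K :=
  hH.imp fun _ ⟨f⟩ => ⟨e.symm.trans f⟩

theorem pow_eq_self_of_modEq_one {G : Type*} [Monoid G] {p r : ℕ} (hr : r ≡ 1 [MOD p]) {g : G}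
    (hg : g ^ p = 1) : g ^ r = g := by
  simpa using pow_eq_pow_of_modEq hr hg

theorem mul_pow_eq_of_mem_center {G : Type*} [Group G] {N : Subgroup G}
    (hcentral : N ≤ Subgroup.center G) {r : ℕ} (hr : Nat.card N ∣ r) (g : G) {n : G}
    (hn : n ∈ N) : (g * n) ^ r = g ^ r := by
  have hcomm : Commute g n := Subgroup.mem_center_iff.mp (hcentral hn) g
  rw [hcomm.mul_pow, orderOf_dvd_iff_pow_eq_one.mp ((N.orderOf_dvd_natCard hn).trans hr), mul_one]

theorem exists_card_dvd_and_modEq_one {p m : ℕ} (hp : p.Prime) (hm : ¬ p ∣ m) :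
    ∃ r : ℕ, m ∣ r ∧ r ≡ 1 [MOD p] := by
  obtain ⟨r, h₁, h₂⟩ := Nat.chineseRemainder ((hp.coprime_iff_not_dvd.mpr hm).symm) 0 1
  exact ⟨r, (Nat.modEq_zero_iff_dvd).mp h₁, h₂⟩

theorem le_of_map_mk'_le {G : Type*} [Group G] {N : Subgroup G} [N.Normal]
    (hcentral : N ≤ Subgroup.center G) {p r : ℕ} (hr : Nat.card N ∣ r) (hr' : r ≡ 1 [MOD p])
    {H₁ H₂ : Subgroup G} (h₁ : ∀ h ∈ H₁, h ^ p = 1) (h₂ : ∀ h ∈ H₂, h ^ p = 1)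
    (hle : H₁.map (QuotientGroup.mk' N) ≤ H₂.map (QuotientGroup.mk' N)) : H₁ ≤ H₂ := by
  intro x hx
  obtain ⟨y, hy, hyx⟩ := hle (Subgroup.mem_map_of_mem _ hx)
  obtain ⟨n, hn, rfl⟩ := (QuotientGroup.mk'_eq_mk' N).mp hyx
  have := mul_pow_eq_of_mem_center hcentral hr y hn
  rw [pow_eq_self_of_modEq_one hr' (h₁ _ hx), pow_eq_self_of_modEq_one hr' (h₂ _ hy)] at this
  rwa [this]

theorem nonempty_mulEquiv_map_mk' {G : Type*} [Group G] {N : Subgroup G} [N.Normal]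
    {p r : ℕ} (hr : Nat.card N ∣ r) (hr' : r ≡ 1 [MOD p])
    {H : Subgroup G} (hH : ∀ h ∈ H, h ^ p = 1) :
    Nonempty (H ≃* H.map (QuotientGroup.mk' N)) := by
  refine ⟨MulEquiv.ofBijective ((QuotientGroup.mk' N).subgroupMap H)
    ⟨(injective_iff_map_eq_one _).mpr ?_, (QuotientGroup.mk' N).subgroupMap_surjective H⟩⟩
  rintro ⟨x, hx⟩ hx1
  have hxN : x ∈ N := (QuotientGroup.eq_one_iff x).mp (congrArg Subtype.val hx1)
  ext
  change x = 1
  rw [← pow_eq_self_of_modEq_one hr' (hH x hx)]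
  exact orderOf_dvd_iff_pow_eq_one.mp ((N.orderOf_dvd_natCard hxN).trans hr)

/-- An abelian subgroup of exponent `p` of a quotient by a central subgroup of order prime to `p`
lifts to a
subgroup of exponent `p`, consisting of all elements of order dividing `p` in its preimage. -/
theorem exists_map_mk'_eq {G : Type*} [Group G] {N : Subgroup G} [N.Normal]
    (hcentral : N ≤ Subgroup.center G) {p r : ℕ} (hr : Nat.card N ∣ r) (hr' : r ≡ 1 [MOD p])
    {K : Subgroup (G ⧸ N)} (hK : ∀ k ∈ K, k ^ p = 1)
    (hcomm : ∀ x ∈ K, ∀ y ∈ K, x * y = y * x) :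
    ∃ H : Subgroup G, (∀ h ∈ H, h ^ p = 1) ∧ H.map (QuotientGroup.mk' N) = K := by
  have commute_of_mem : ∀ x y : G, (x : G ⧸ N) ∈ K → (y : G ⧸ N) ∈ K → x ^ p = 1 →
      Commute x y := by
    intro x y hx hy hxp
    obtain ⟨n, hn, hxn⟩ := (QuotientGroup.mk'_eq_mk' N (x := x) (y := y * x * y⁻¹)).mp (by
      simp [← hcomm _ hx _ hy])
    have hpow := mul_pow_eq_of_mem_center hcentral hr x hn
    rw [hxn, conj_pow, pow_eq_self_of_modEq_one hr' hxp] at hpow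
    exact (mul_inv_eq_iff_eq_mul.mp hpow).symm
  let H : Subgroup G :=
    { carrier := {x | (x : G ⧸ N) ∈ K ∧ x ^ p = 1}
      one_mem' := ⟨K.one_mem, one_pow p⟩
      mul_mem' := fun {x y} hx hy => ⟨K.mul_mem hx.1 hy.1, by
        rw [(commute_of_mem x y hx.1 hy.1 hx.2).mul_pow, hx.2, hy.2, one_mul]⟩
      inv_mem' := fun {x} hx => ⟨K.inv_mem hx.1, by rw [inv_pow, hx.2, inv_one]⟩ }
  refine ⟨H, fun h hh => hh.2, le_antisymm ?_ ?_⟩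
  · rintro _ ⟨x, hx, rfl⟩
    exact hx.1
  · intro k hk
    obtain ⟨g, rfl⟩ := QuotientGroup.mk'_surjective N k
    have hgr : QuotientGroup.mk' N (g ^ r) = QuotientGroup.mk' N g := by
      rw [map_pow, pow_eq_self_of_modEq_one hr' (hK _ hk)]
    have hgp : g ^ p ∈ N := (QuotientGroup.eq_one_iff _).mp (hK _ hk)
    refine ⟨g ^ r, ⟨?_, ?_⟩, hgr⟩
    · change QuotientGroup.mk' N (g ^ r) ∈ K
      rwa [hgr]
    · rw [pow_right_comm]
      exact orderOf_dvd_iff_pow_eq_one.mp ((N.orderOf_dvd_natCard hgp).trans hr)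

/-- If `N` is a central subgroup of the finite group `G` of order not divisible by the prime
`p`, then `H ↦ H.map (QuotientGroup.mk' N)` is a bijection from the set of nontrivial
elementary abelian `p`-subgroups of `G` onto the set of nontrivial elementary abelian
`p`-subgroups of `G/N` which preserves and reflects inclusion: it is an isomorphism of
posets `A_p(G) ≅ A_p(G/N)`. -/
theorem ap_poset_iso_central_quotient (p : ℕ) (hp : p.Prime)
    (G : Type*) [Group G] [Finite G] (N : Subgroup G) [N.Normal]
    (hcentral : N ≤ Subgroup.center G) (hcard : ¬ p ∣ Nat.card N) :
    Set.BijOn (fun H : Subgroup G => H.map (QuotientGroup.mk' N))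
      {H : Subgroup G | IsElementaryAbelian p H ∧ H ≠ ⊥}
      {K : Subgroup (G ⧸ N) | IsElementaryAbelian p K ∧ K ≠ ⊥} ∧
    ∀ H₁ H₂ : Subgroup G,
      (IsElementaryAbelian p H₁ ∧ H₁ ≠ ⊥) → (IsElementaryAbelian p H₂ ∧ H₂ ≠ ⊥) →
      (H₁ ≤ H₂ ↔ H₁.map (QuotientGroup.mk' N) ≤ H₂.map (QuotientGroup.mk' N)) := by
  obtain ⟨r, hr, hr'⟩ := exists_card_dvd_and_modEq_one hp hcard
  have reflect : ∀ H₁ H₂ : Subgroup G, (∀ h ∈ H₁, h ^ p = 1) → (∀ h ∈ H₂, h ^ p = 1) →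
      H₁.map (QuotientGroup.mk' N) ≤ H₂.map (QuotientGroup.mk' N) → H₁ ≤ H₂ :=
    fun _ _ => le_of_map_mk'_le hcentral hr hr'
  refine ⟨⟨?_, ?_, ?_⟩, ?_⟩
  · rintro H ⟨hH, hne⟩
    have hpow : ∀ h ∈ H, h ^ p = 1 := fun _ => hH.pow_eq_one
    obtain ⟨e⟩ := nonempty_mulEquiv_map_mk' hr hr' hpow
    refine ⟨hH.of_mulEquiv e, fun hbot => hne (le_bot_iff.mp ?_)⟩
    exact reflect H ⊥ hpow (by simp) (by rw [Subgroup.map_bot]; exact hbot.le)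
  · rintro H₁ ⟨h₁, -⟩ H₂ ⟨h₂, -⟩ heq
    exact le_antisymm
      (reflect _ _ (fun _ => h₁.pow_eq_one) (fun _ => h₂.pow_eq_one) heq.le)
      (reflect _ _ (fun _ => h₂.pow_eq_one) (fun _ => h₁.pow_eq_one) heq.ge)
  · rintro K ⟨hK, hne⟩
    obtain ⟨H, hpow, rfl⟩ := exists_map_mk'_eq hcentral hr hr' (fun _ => hK.pow_eq_one)
      (fun _ hx _ hy => hK.commute hx hy)
    obtain ⟨e⟩ := nonempty_mulEquiv_map_mk' hr hr' hpow
    refine ⟨H, ⟨hK.of_mulEquiv e.symm, ?_⟩, rfl⟩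
    rintro rfl
    exact hne (Subgroup.map_bot _)
  · rintro H₁ H₂ ⟨h₁, -⟩ ⟨h₂, -⟩
    exact ⟨fun h => Subgroup.map_mono h,
      reflect _ _ (fun _ => h₁.pow_eq_one) (fun _ => h₂.pow_eq_one)⟩
end

section
/- Let p be a prime and G a finite group. Then the reduced Euler characteristic of A_p(G) is given by χ̃(A_p(G)) = Σ_E (-1)^{rank(E)+1} · p^{C(rank(E),2)}, where the sum runs over ALL elementary abelian p-subgroups E of G, including the trivial subgroup (which contributes the term (-1)^{0+1} · p^0 = -1), and C(m,2) = m(m-1)/2 is the binomial coefficient. -/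
/-- The rank of an elementary abelian `p`-subgroup: if `H ≅ (ℤ/pℤ)^n` and `p` is prime,
then `Nat.card H = p ^ n`, so this equals `n`. -/
noncomputable def rankOf (p : ℕ) {G : Type*} [Group G] (H : Subgroup G) : ℕ :=
  Nat.log p (Nat.card H)

/-- The number of chains `E₀ < E₁ < ⋯ < E_k` of length `k` of nontrivial elementary abelian
`p`-subgroups of `G`, i.e. of strictly increasing `(k+1)`-tuples in `A_p(G)`. -/
noncomputable def apChainCount (p : ℕ) (G : Type*) [Group G] (k : ℕ) : ℕ :=
  Nat.card {c : Fin (k + 1) → Subgroup G //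
    StrictMono c ∧ ∀ i, IsElementaryAbelian p (c i) ∧ c i ≠ ⊥}

/-- The reduced Euler characteristic of the poset `A_p(G)`:
`χ̃(A_p(G)) = -1 + ∑_{k ≥ 0} (-1)^k c_k` where `c_k` is the number of chains of length `k`. -/
noncomputable def reducedEulerChar (p : ℕ) (G : Type*) [Group G] : ℤ :=
  -1 + ∑ᶠ k : ℕ, (-1 : ℤ) ^ k * (apChainCount p G k : ℤ)

namespace Submodule

variable {K V : Type*} [Field K] [AddCommGroup V] [Module K V]

/-- The complements of a subspace `p` form a torsor under `Hom (V ⧸ p, p)`. -/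
noncomputable def isComplEquivQuotientHom (p : Submodule K V) (f₀ : V →ₗ[K] p)
    (hf₀ : ∀ x : p, f₀ x = x) : {q // IsCompl p q} ≃ (V ⧸ p →ₗ[K] p) :=
  p.isComplEquivProj.trans
    { toFun f := p.liftQ (f.1 - f₀) fun x hx => by
        have h₁ := f.2 ⟨x, hx⟩
        have h₂ := hf₀ ⟨x, hx⟩
        simp_all
      invFun g := ⟨g ∘ₗ p.mkQ + f₀, fun x => by
        simp [hf₀, (Quotient.mk_eq_zero p).2 x.2]⟩
      left_inv f := by ext; simp
      right_inv g := by ext; simp }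

theorem natCard_isCompl [Finite K] [FiniteDimensional K V] (p : Submodule K V) :
    Nat.card {q // IsCompl p q} =
      Nat.card K ^ ((Module.finrank K V - Module.finrank K p) * Module.finrank K p) := by
  obtain ⟨f₀, hf₀⟩ := p.subtype.exists_leftInverse_of_injective p.ker_subtype
  rw [Nat.card_congr (p.isComplEquivQuotientHom f₀ fun x => LinearMap.congr_fun hf₀ x),
    Module.natCard_eq_pow_finrank (K := K), Module.finrank_linearMap, p.finrank_quotient]

theorem natCard_disjoint_sup_eq [Finite K] [FiniteDimensional K V] {L U : Submodule K V}
    (hLU : L ≤ U) : Nat.card {W // Disjoint L W ∧ L ⊔ W = U} =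
      Nat.card K ^ ((Module.finrank K U - Module.finrank K L) * Module.finrank K L) := by
  have h := natCard_isCompl (L.submoduleOf U)
  rw [(submoduleOfEquivOfLe hLU).finrank_eq] at h
  rw [← h]
  symm
  have hL : U.mapIic (L.submoduleOf U) = ⟨L, hLU⟩ := by
    ext1
    simp [submoduleOf, map_comap_subtype, hLU]
  refine Nat.card_congr ((U.mapIic.toEquiv.subtypeEquiv
    (q := fun W => IsCompl (⟨L, hLU⟩ : Set.Iic U) W) fun q => ?_).trans
    { toFun W := ⟨W.1.1, Set.Iic.isCompl_iff.1 W.2⟩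
      invFun W := ⟨⟨W.1, le_sup_right.trans_eq W.2.2⟩, Set.Iic.isCompl_iff.2 W.2⟩
      left_inv _ := rfl
      right_inv _ := rfl })
  rw [U.mapIic.isCompl_iff, hL]
  rfl

theorem sum_neg_one_pow_finrank_mul [Finite K] [FiniteDimensional K V] [Nontrivial V]
    [Fintype (Submodule K V)] :
    ∑ W : Submodule K V, (-1 : ℤ) ^ (Module.finrank K W + 1) *
      (Nat.card K : ℤ) ^ (Module.finrank K W).choose 2 = 0 := by
  classical
  obtain ⟨v, hv⟩ := exists_ne (0 : V)
  set L := K ∙ v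
  have hL1 : Module.finrank K L = 1 := finrank_span_singleton hv
  have hatom : IsAtom L := nonzero_span_atom v hv
  rw [← Finset.sum_filter_add_sum_filter_not _ (fun W => L ≤ W),
    ← Finset.sum_fiberwise_of_maps_to (s := {W | ¬ L ≤ W}) (t := {W | L ≤ W})
      (g := fun W => L ⊔ W) (by simp), ← Finset.sum_add_distrib]
  refine Finset.sum_eq_zero fun U hU => ?_
  replace hU : L ≤ U := by simpa using hU
  obtain ⟨d, hd⟩ : ∃ d, Module.finrank K U = d + 1 :=
    Nat.exists_eq_add_of_le' (hL1 ▸ finrank_mono hU)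
  have hfib : ∀ W ∈ ({W | ¬ L ≤ W} : Finset (Submodule K V)).filter (fun W => L ⊔ W = U),
      (-1 : ℤ) ^ (Module.finrank K W + 1) * (Nat.card K : ℤ) ^ (Module.finrank K W).choose 2 =
      (-1 : ℤ) ^ (d + 1) * (Nat.card K : ℤ) ^ d.choose 2 := by
    intro W hW
    simp only [Finset.mem_filter, Finset.mem_univ, true_and] at hW
    have h := finrank_sup_add_finrank_inf_eq L W
    rw [hW.2, (hatom.not_le_iff_disjoint.1 hW.1).eq_bot, finrank_bot, hL1] at h
    rw [show Module.finrank K W = d by omega]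
  have hcard := natCard_disjoint_sup_eq hU
  rw [hd, hL1, Nat.add_sub_cancel, mul_one] at hcard
  rw [Finset.sum_congr rfl hfib, Finset.sum_const, Finset.filter_filter, ← Fintype.card_subtype,
    ← Nat.card_eq_fintype_card]
  simp only [← hatom.not_le_iff_disjoint] at hcard
  rw [hcard, hd, Nat.choose_succ_succ' d 1]
  simp
  ring

end Submodule

section Chains

variable {α : Type*}

/-- A chain with `k + 2` terms is a chain with `k + 1` terms preceded by a smaller element. -/
def strictMonoConsEquiv [Preorder α] (S : Set α) (k : ℕ) :
    {c : Fin (k + 2) → α // StrictMono c ∧ ∀ i, c i ∈ S} ≃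
      (c : {c : Fin (k + 1) → α // StrictMono c ∧ ∀ i, c i ∈ S}) × {a // a ∈ S ∧ a < c.1 0} where
  toFun c := ⟨⟨Fin.tail c.1, c.2.1.comp (Fin.strictMono_succ), fun i => c.2.2 i.succ⟩,
    ⟨c.1 0, c.2.2 0, c.2.1 (Fin.succ_pos 0)⟩⟩
  invFun x := ⟨Fin.cons x.2.1 x.1.1, strictMono_vecCons.2 ⟨x.2.2.2, x.1.2.1⟩,
    Fin.cases x.2.2.1 x.1.2.2⟩
  left_inv c := Subtype.ext (Fin.cons_self_tail c.1)
  right_inv _ := rfl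

theorem finsum_neg_one_pow_mul_natCard_strictMono [Preorder α] [Finite α] (S : Set α) (h : α → ℤ)
    (hS : ∀ a ∈ S, ∑ᶠ b : {b // b ∈ S ∧ b < a}, h b = 1 - h a) :
    ∑ᶠ k : ℕ, (-1 : ℤ) ^ k *
      (Nat.card {c : Fin (k + 1) → α // StrictMono c ∧ ∀ i, c i ∈ S} : ℤ) = ∑ᶠ a : S, h a := by
  classical
  have := Fintype.ofFinite α
  let C (k : ℕ) := {c : Fin (k + 1) → α // StrictMono c ∧ ∀ i, c i ∈ S}
  let T (k : ℕ) : ℤ := ∑ c : C k, h (c.1 0)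
  have hcard (k : ℕ) : (Nat.card (C k) : ℤ) = T k + T (k + 1) := by
    have : T (k + 1) = ∑ c : C k, (1 - h (c.1 0)) := by
      refine ((strictMonoConsEquiv S k).symm.sum_comp _).symm.trans ?_
      rw [Fintype.sum_sigma]
      refine Finset.sum_congr rfl fun c _ => ?_
      rw [← hS _ (c.2.2 0), finsum_eq_sum_of_fintype]
      rfl
    simp [this, T]
  have hempty {k : ℕ} (hk : Fintype.card α ≤ k) : IsEmpty (C k) := ⟨fun c => by
    have := Fintype.card_le_of_injective _ c.2.1.injective
    simp at this
    omega⟩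
  have hsum (n : ℕ) : ∑ k ∈ Finset.range n, (-1 : ℤ) ^ k * (Nat.card (C k) : ℤ) =
      T 0 - (-1) ^ n * T n := by
    induction n with
    | zero => simp
    | succ n ih => rw [Finset.sum_range_succ, ih, hcard]; ring
  have hT : T (Fintype.card α) = 0 := by
    have := hempty le_rfl
    simp [T]
  rw [finsum_eq_sum_of_support_subset (s := Finset.range (Fintype.card α)), hsum, hT, mul_zero,
    sub_zero, finsum_eq_sum_of_fintype]
  · refine Fintype.sum_equiv
      ⟨fun c => ⟨c.1 0, c.2.2 0⟩, fun a => ⟨fun _ => a.1, Subsingleton.strictMono (α := Fin 1) _, fun _ => a.2⟩,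
        fun c => Subtype.ext (funext fun i => by rw [Subsingleton.elim (α := Fin 1) i 0]), fun _ => rfl⟩
      _ _ fun _ => rfl
  · intro k hk
    by_contra hk'
    have := hempty (k := k) (by simpa using hk')
    exact hk (by simp [C] at this ⊢)

end Chains

section ElementaryAbelian

variable {p : ℕ} {G : Type*} [Group G]

/-- An isomorphism from a subgroup `E` to an `𝔽_p`-vector space identifies the subgroups of `E`
with the subspaces. -/
def submoduleEquivSubgroupLE {V : Type*} [AddCommGroup V] [Module (ZMod p) V] {E : Subgroup G}
    (φ : E ≃* Multiplicative V) : Submodule (ZMod p) V ≃o {F : Subgroup G // F ≤ E} :=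
  (AddSubgroup.toZModSubmodule p).symm.trans <| AddSubgroup.toSubgroup.trans <|
    φ.symm.mapSubgroup.trans (Subgroup.MapSubtype.orderIso E)

/-- A subspace is isomorphic to the subgroup corresponding to it. -/
noncomputable def mulEquivSubmoduleEquivSubgroupLE {V : Type*} [AddCommGroup V]
    [Module (ZMod p) V] {E : Subgroup G} (φ : E ≃* Multiplicative V)
    (W : Submodule (ZMod p) V) :
    Multiplicative W ≃* (submoduleEquivSubgroupLE φ W).1 :=
  let W' : Subgroup (Multiplicative V) := AddSubgroup.toSubgroup W.toAddSubgroup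
  let e : Multiplicative W ≃* W' := MulEquiv.refl _
  e.trans <| (W'.equivMapOfInjective φ.symm.toMonoidHom φ.symm.injective).trans
    ((W'.map φ.symm.toMonoidHom).equivMapOfInjective E.subtype E.subtype_injective)

theorem rankOf_eq_finrank [Fact p.Prime] {V : Type*} [AddCommGroup V] [Module (ZMod p) V]
    [FiniteDimensional (ZMod p) V] {F : Subgroup G} (e : Multiplicative V ≃* F) :
    rankOf p F = Module.finrank (ZMod p) V := by
  rw [rankOf, ← Nat.card_congr e.toEquiv, Nat.card_congr Multiplicative.toAdd,
    Module.natCard_eq_pow_finrank (K := ZMod p), Nat.card_zmod,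
    Nat.log_pow (Fact.out : p.Prime).one_lt]

theorem IsElementaryAbelian.mono [Fact p.Prime] {E F : Subgroup G} (hE : IsElementaryAbelian p E)
    (hFE : F ≤ E) : IsElementaryAbelian p F := by
  obtain ⟨n, ⟨φ⟩⟩ := hE
  obtain ⟨W, hW⟩ := (submoduleEquivSubgroupLE (p := p) φ).surjective ⟨F, hFE⟩
  have e := mulEquivSubmoduleEquivSubgroupLE φ W
  rw [hW] at e
  exact ⟨_, ⟨e.symm.trans (Module.finBasis (ZMod p) W).equivFun.toAddEquiv.toMultiplicative⟩⟩

theorem isElementaryAbelian_bot : IsElementaryAbelian p (⊥ : Subgroup G) :=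
  ⟨0, ⟨MulEquiv.ofUnique⟩⟩

theorem rankOf_bot : rankOf p (⊥ : Subgroup G) = 0 := by simp [rankOf]

theorem IsElementaryAbelian.finsum_le_eq_zero [Fact p.Prime] {E : Subgroup G}
    (hE : IsElementaryAbelian p E) (hE' : E ≠ ⊥) :
    ∑ᶠ F : {F : Subgroup G // F ≤ E},
      (-1 : ℤ) ^ (rankOf p F.1 + 1) * (p : ℤ) ^ (rankOf p F.1).choose 2 = 0 := by
  obtain ⟨n, ⟨φ⟩⟩ := hE
  have : Nontrivial (Fin n → ZMod p) :=
    have := E.nontrivial_iff_ne_bot.2 hE'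
    Multiplicative.toAdd.symm.trans φ.symm.toEquiv |>.nontrivial
  have := Fintype.ofFinite (Submodule (ZMod p) (Fin n → ZMod p))
  rw [← finsum_comp_equiv (submoduleEquivSubgroupLE (p := p) φ).toEquiv, finsum_eq_sum_of_fintype]
  refine (Finset.sum_congr rfl fun W _ => ?_).trans
    (Submodule.sum_neg_one_pow_finrank_mul (K := ZMod p) (V := Fin n → ZMod p))
  rw [← rankOf_eq_finrank (mulEquivSubmoduleEquivSubgroupLE φ W), Nat.card_zmod]
  rfl

end ElementaryAbelian

/-- The reduced Euler characteristic of `A_p(G)` equals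
`∑_E (-1)^(rank E + 1) * p^(rank E choose 2)`, the sum running over all elementary abelian
`p`-subgroups `E` of `G` including the trivial one (which contributes `-1`). -/
theorem reducedEulerChar_eq_sum (p : ℕ) (hp : p.Prime) (G : Type*) [Group G] [Finite G] :
    reducedEulerChar p G =
      ∑ᶠ E : {E : Subgroup G // IsElementaryAbelian p E},
        (-1 : ℤ) ^ (rankOf p E.1 + 1) * (p : ℤ) ^ Nat.choose (rankOf p E.1) 2 := by
  have : Fact p.Prime := ⟨hp⟩
  let h : Subgroup G → ℤ :=
    fun E => (-1 : ℤ) ^ (rankOf p E + 1) * (p : ℤ) ^ (rankOf p E).choose 2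
  change _ = ∑ᶠ E : {E : Subgroup G // IsElementaryAbelian p E}, h E.1
  have hbot : h ⊥ = -1 := by simp [h, rankOf_bot]
  let S : Set (Subgroup G) := {E | IsElementaryAbelian p E ∧ E ≠ ⊥}
  have hS : ∀ E ∈ S, ∑ᶠ F : {F // F ∈ S ∧ F < E}, h F = 1 - h E := by
    intro E hE
    have hset : {F | F ≤ E} = insert ⊥ (insert E {F | F ∈ S ∧ F < E}) := by
      ext F
      simp only [Set.mem_ofPred_eq, Set.mem_insert_iff]
      refine ⟨fun hF => ?_, ?_⟩
      · rcases eq_or_ne F ⊥ with h₁ | h₁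
        · exact Or.inl h₁
        · exact Or.inr (hF.eq_or_lt.imp_right fun h₂ => ⟨⟨hE.1.mono hF, h₁⟩, h₂⟩)
      · rintro (rfl | rfl | ⟨-, hF⟩)
        exacts [bot_le, le_rfl, hF.le]
    have hsum : ∑ᶠ F ∈ {F | F ≤ E}, h F = 0 :=
      (finsum_set_coe_eq_finsum_mem {F | F ≤ E}).symm.trans (hE.1.finsum_le_eq_zero hE.2)
    rw [hset, finsum_mem_insert _ (by simp [S, hE.2.symm]) (Set.toFinite _),
      finsum_mem_insert _ (by simp) (Set.toFinite _), hbot] at hsum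
    have : ∑ᶠ F : {F // F ∈ S ∧ F < E}, h F = ∑ᶠ F ∈ {F | F ∈ S ∧ F < E}, h F :=
      finsum_set_coe_eq_finsum_mem {F | F ∈ S ∧ F < E}
    linarith
  have hchain : reducedEulerChar p G = -1 + ∑ᶠ E ∈ S, h E := by
    rw [← finsum_set_coe_eq_finsum_mem, ← finsum_neg_one_pow_mul_natCard_strictMono S h hS]
    rfl
  have hinsert : {E : Subgroup G | IsElementaryAbelian p E} = insert ⊥ S := by
    ext E
    rcases eq_or_ne E ⊥ with rfl | hE
    · simp [isElementaryAbelian_bot]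
    · simp [S, hE]
  rw [hchain, ← hbot, ← finsum_mem_insert _ (by simp [S]) (Set.toFinite _), ← hinsert,
    ← finsum_set_coe_eq_finsum_mem]
  rfl
end

section
/- Let q be an odd prime power. Then the 2-rank of PSL_2(q) equals 2; that is, every elementary abelian 2-subgroup of PSL_2(q) has order at most 4, and PSL_2(q) contains a subgroup isomorphic to ℤ/2ℤ × ℤ/2ℤ. -/
/-- `PGL₂(F)`: the quotient of `GL(2,F)` by its center. -/
abbrev PGL2 (F : Type*) [Field F] :=
  Matrix.GeneralLinearGroup (Fin 2) F ⧸ Subgroup.center (Matrix.GeneralLinearGroup (Fin 2) F)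

/-- `PSL₂(F)`: the image of `SL(2,F)` in `PGL₂(F)` under the natural map. -/
def PSL2 (F : Type*) [Field F] : Subgroup (PGL2 F) :=
  ((QuotientGroup.mk' (Subgroup.center (Matrix.GeneralLinearGroup (Fin 2) F))).comp
    Matrix.SpecialLinearGroup.toGL).range

/-- The Klein four-subgroup generated by two commuting elements of order dividing two. -/
def kleinFourSubgroup {G : Type*} [Group G] (a b : G) (ha : a * a = 1) (hb : b * b = 1)
    (hab : a * b = b * a) : Subgroup G where
  carrier := {1, a, b, a * b}
  one_mem' := by simp
  mul_mem' := by
    have ha' (x : G) : a * (a * x) = x := by rw [← mul_assoc, ha, one_mul]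
    have hab' (x : G) : b * (a * x) = a * (b * x) := by rw [← mul_assoc, ← hab, mul_assoc]
    rintro x y (rfl | rfl | rfl | rfl) (rfl | rfl | rfl | rfl) <;>
      simp [mul_assoc, ha, hb, ha', hab', ← hab]
  inv_mem' := by
    rintro x (rfl | rfl | rfl | rfl) <;>
      simp [inv_eq_of_mul_eq_one_right ha, inv_eq_of_mul_eq_one_right hb, ← hab]

theorem isKleinFour_kleinFourSubgroup {G : Type*} [Group G] {a b : G} (ha : a * a = 1)
    (hb : b * b = 1) (hab : a * b = b * a) (ha1 : a ≠ 1) (hb1 : b ≠ 1) (hne : a ≠ b) :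
    IsKleinFour (kleinFourSubgroup a b ha hb hab) where
  card_four := by
    classical
    have hab1 : a * b ≠ 1 := fun h => hne (mul_left_cancel (ha.trans h.symm))
    have hset : (kleinFourSubgroup a b ha hb hab : Set G)
        = (({1, a, b, a * b} : Finset G) : Set G) := by
      simp [kleinFourSubgroup]
    rw [← SetLike.coe_sort_coe, hset, Nat.card_coe_set_eq, Set.ncard_coe_finset]
    simp [Finset.card_insert_of_notMem, ha1.symm, hb1.symm, hab1.symm, hne, ha1, hb1]
  exponent_two := by
    have hab' (x : G) : b * (a * x) = a * (b * x) := by rw [← mul_assoc, ← hab, mul_assoc]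
    have hdvd : Monoid.exponent (kleinFourSubgroup a b ha hb hab) ∣ 2 := by
      refine Monoid.exponent_dvd_of_forall_pow_eq_one fun ⟨x, hx⟩ => Subtype.ext ?_
      rcases hx with rfl | rfl | rfl | rfl <;> simp [pow_two, mul_assoc, ha, hb, hab']
    refine ((Nat.dvd_prime Nat.prime_two).mp hdvd).resolve_left fun h => ha1 ?_
    have := Monoid.pow_exponent_eq_one
      (⟨a, by simp [kleinFourSubgroup]⟩ : kleinFourSubgroup a b ha hb hab)
    simpa [h] using congrArg Subtype.val this

namespace PSL2

open Matrix

variable {F : Type*} [Field F]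

/-- The natural surjection from `SL(2,F)` onto `PSL₂(F)`. -/
def ofSL : SpecialLinearGroup (Fin 2) F →* PSL2 F :=
  ((QuotientGroup.mk' (Subgroup.center (GeneralLinearGroup (Fin 2) F))).comp
    SpecialLinearGroup.toGL).rangeRestrict

theorem ofSL_surjective : Function.Surjective (ofSL (F := F)) :=
  MonoidHom.rangeRestrict_surjective _

theorem ofSL_eq_one_iff (g : SpecialLinearGroup (Fin 2) F) : ofSL g = 1 ↔ g = 1 ∨ g = -1 := by
  have h : ofSL g = 1 ↔ SpecialLinearGroup.toGL g ∈
      Subgroup.center (GeneralLinearGroup (Fin 2) F) := by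
    rw [← QuotientGroup.eq_one_iff, ← Subtype.coe_inj]
    rfl
  rw [h, SpecialLinearGroup.toGL_mem_center_iff, Matrix.SpecialLinearGroup.mem_center_iff]
  constructor
  · rintro ⟨r, hr, hg⟩
    rcases mul_self_eq_one_iff.mp (by simpa [pow_two] using hr : r * r = 1) with rfl | rfl
    · left; ext i j; simp [← hg]
    · right; ext i j; fin_cases i <;> fin_cases j <;> simp [← hg]
  · rintro (rfl | rfl)
    · exact ⟨1, by simp, by simp⟩
    · exact ⟨-1, by simp, by simp [← diagonal_one]⟩

theorem mul_self_eq_neg_one (h2 : (2 : F) ≠ 0) {g : SpecialLinearGroup (Fin 2) F}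
    (hg : ofSL g * ofSL g = 1) (hg1 : ofSL g ≠ 1) : g * g = -1 := by
  rw [← map_mul, ofSL_eq_one_iff] at hg
  refine hg.resolve_left fun h => hg1 ((ofSL_eq_one_iff g).mpr ?_)
  have hd := g.det_coe
  rw [det_fin_two] at hd
  have e (i j) := congrArg (fun m : SpecialLinearGroup (Fin 2) F => m i j) h
  have e00 := e 0 0
  have e01 := e 0 1
  have e10 := e 1 0
  simp [Matrix.mul_apply, Fin.sum_univ_two] at e00 e01 e10
  have ht : g 0 0 + g 1 1 ≠ 0 := fun ht => h2 (by linear_combination g 0 0 * ht - e00 - hd)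
  have hb : g 0 1 = 0 := by
    refine (mul_eq_zero.mp ?_).resolve_right ht
    linear_combination e01
  have hc : g 1 0 = 0 := by
    refine (mul_eq_zero.mp ?_).resolve_right ht
    linear_combination e10
  have hda : g 1 1 = g 0 0 := by
    linear_combination g 0 0 * hd - g 1 1 * e00 + (g 0 0 * g 1 0 + g 1 1 * g 1 0) * hb
  have ha : g 0 0 = 1 ∨ g 0 0 = -1 := mul_self_eq_one_iff.mp (by
    linear_combination e00 - g 1 0 * hb)
  refine ha.imp (fun ha => ?_) (fun ha => ?_) <;> ext i j <;> fin_cases i <;> fin_cases j <;>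
    simp [ha, hb, hc, hda]

theorem neg_ne_self (h2 : (2 : F) ≠ 0) (g : SpecialLinearGroup (Fin 2) F) : g ≠ -g := by
  intro h
  have h1 : (1 : SpecialLinearGroup (Fin 2) F) = -1 := by
    simpa using congrArg (· * g⁻¹) h
  have := congrArg (fun m : SpecialLinearGroup (Fin 2) F => m 0 0) h1
  simp at this
  exact h2 (by linear_combination this)

/-- Lifts to `SL(2,F)` of distinct commuting involutions of `PSL₂(F)` anticommute. -/
theorem mul_eq_neg_mul (h2 : (2 : F) ≠ 0) {x y : SpecialLinearGroup (Fin 2) F}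
    (hx : ofSL x * ofSL x = 1) (hy : ofSL y * ofSL y = 1) (hx1 : ofSL x ≠ 1) (hy1 : ofSL y ≠ 1)
    (hne : ofSL x ≠ ofSL y) (hc : Commute (ofSL x) (ofSL y)) : x * y = -(y * x) := by
  have hxx := mul_self_eq_neg_one h2 hx hx1
  have hyy := mul_self_eq_neg_one h2 hy hy1
  have hxy : (x * y) * (x * y) = -1 := by
    apply mul_self_eq_neg_one h2
    · rw [map_mul, hc.symm.mul_mul_mul_comm, hx, hy, one_mul]
    · rw [map_mul]
      exact fun h => hne (mul_left_cancel (hx.trans h.symm))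
  have hyxy : y * x * y = x := by
    calc y * x * y = -(x * x * (y * x * y)) := by simp [hxx]
      _ = -(x * ((x * y) * (x * y))) := by simp only [mul_assoc]
      _ = x := by simp [hxy]
  calc x * y = y * x * y * y := by rw [hyxy]
    _ = y * x * (y * y) := mul_assoc _ _ _
    _ = -(y * x) := by simp [hyy]

/-- The centralizer of a four-group of `PSL₂(F)` contains no further involutions. -/
theorem eq_of_commute (h2 : (2 : F) ≠ 0) {a b c : PSL2 F} (ha : a * a = 1) (hb : b * b = 1)
    (hc : c * c = 1) (ha1 : a ≠ 1) (hb1 : b ≠ 1) (hne : a ≠ b) (hab : Commute a b)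
    (hac : Commute a c) (hbc : Commute b c) : c = 1 ∨ c = a ∨ c = b ∨ c = a * b := by
  by_contra! h
  obtain ⟨hc1, hca, hcb, hcab⟩ := h
  obtain ⟨x, rfl⟩ := ofSL_surjective a
  obtain ⟨y, rfl⟩ := ofSL_surjective b
  obtain ⟨z, rfl⟩ := ofSL_surjective c
  have hxz := mul_eq_neg_mul h2 ha hc ha1 hc1 hca.symm hac
  have hyz := mul_eq_neg_mul h2 hb hc hb1 hc1 hcb.symm hbc
  have hxyz : (x * y) * z = -(z * (x * y)) := by
    rw [← map_mul] at hcab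
    refine mul_eq_neg_mul h2 ?_ hc ?_ hc1 hcab.symm ?_ <;> rw [map_mul]
    · rw [hab.symm.mul_mul_mul_comm, ha, hb, one_mul]
    · exact fun h => hne (mul_left_cancel (ha.trans h.symm))
    · exact hac.mul_left hbc
  refine neg_ne_self h2 (z * (x * y)) ?_
  rw [← hxyz, mul_assoc x, hyz, mul_neg, ← mul_assoc x, hxz, neg_mul, neg_neg, mul_assoc]

theorem card_le_four (h2 : (2 : F) ≠ 0) (H : Subgroup (PSL2 F)) (hH : ∀ x ∈ H, x * x = 1)
    (hcomm : ∀ x ∈ H, ∀ y ∈ H, Commute x y) : Nat.card H ≤ 4 := by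
  classical
  obtain ⟨a, b, hab⟩ : ∃ a b, ∀ c ∈ H, c = 1 ∨ c = a ∨ c = b ∨ c = a * b := by
    by_cases h : ∃ a ∈ H, ∃ b ∈ H, a ≠ 1 ∧ b ≠ 1 ∧ a ≠ b
    · obtain ⟨a, ha, b, hb, ha1, hb1, hne⟩ := h
      exact ⟨a, b, fun c hc => eq_of_commute h2 (hH a ha) (hH b hb) (hH c hc) ha1 hb1 hne
        (hcomm a ha b hb) (hcomm a ha c hc) (hcomm b hb c hc)⟩
    · push Not at h
      by_cases h' : ∃ a ∈ H, a ≠ 1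
      · obtain ⟨a, ha, ha1⟩ := h'
        exact ⟨a, a, fun c hc => or_iff_not_imp_left.mpr fun hc1 =>
          Or.inl (h a ha c hc ha1 hc1).symm⟩
      · push Not at h'
        exact ⟨1, 1, fun c hc => Or.inl (h' c hc)⟩
  have hsub : (H : Set (PSL2 F)) ⊆ (({1, a, b, a * b} : Finset (PSL2 F)) : Set (PSL2 F)) := by
    intro c hc
    simpa using hab c hc
  calc Nat.card H = (H : Set (PSL2 F)).ncard := Nat.card_coe_set_eq _
    _ ≤ _ := Set.ncard_le_ncard hsub (Finset.finite_toSet _)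
    _ ≤ 4 := (Set.ncard_coe_finset _).trans_le Finset.card_le_four

theorem exists_isKleinFour [Finite F] (h2 : (2 : F) ≠ 0) :
    ∃ H : Subgroup (PSL2 F), IsKleinFour H := by
  obtain ⟨p, hp⟩ := CharP.exists F
  have : NeZero p := ⟨CharP.char_ne_zero_of_finite F p⟩
  obtain ⟨m, n, hmn⟩ := CharP.sq_add_sq F p (-1)
  obtain ⟨u, v, huv⟩ : ∃ u v : F, u ^ 2 + v ^ 2 = -1 := ⟨m, n, by simpa using hmn⟩
  let x : SpecialLinearGroup (Fin 2) F := ⟨!![0, 1; -1, 0], by simp [det_fin_two]⟩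
  let y : SpecialLinearGroup (Fin 2) F := ⟨!![u, v; v, -u], by
    simp only [det_fin_two_of]; linear_combination -huv⟩
  have hx : x * x = -1 := by
    apply Subtype.ext
    simp only [Matrix.SpecialLinearGroup.coe_mul, Matrix.SpecialLinearGroup.coe_neg,
      Matrix.SpecialLinearGroup.coe_one]
    ext i j
    fin_cases i <;> fin_cases j <;> simp [x]
  have hy : y * y = -1 := by
    apply Subtype.ext
    simp only [Matrix.SpecialLinearGroup.coe_mul, Matrix.SpecialLinearGroup.coe_neg,
      Matrix.SpecialLinearGroup.coe_one]
    ext i j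
    fin_cases i <;> fin_cases j <;> simp [y, mul_comm v u] <;>
      linear_combination huv
  have hxy : x * y = -(y * x) := by
    apply Subtype.ext
    simp only [Matrix.SpecialLinearGroup.coe_mul, Matrix.SpecialLinearGroup.coe_neg]
    ext i j
    fin_cases i <;> fin_cases j <;> simp [x, y]
  have hne : (1 : SpecialLinearGroup (Fin 2) F) ≠ -1 := neg_ne_self h2 1
  have hsq {g : SpecialLinearGroup (Fin 2) F} (hg : g * g = -1) : ofSL g * ofSL g = 1 := by
    rw [← map_mul, ofSL_eq_one_iff]
    exact Or.inr hg
  have hne1 {g : SpecialLinearGroup (Fin 2) F} (hg : g * g = -1) : ofSL g ≠ 1 := by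
    rw [Ne, ofSL_eq_one_iff]
    rintro (rfl | rfl) <;> exact hne (by simpa using hg)
  have hneg : ofSL (-1 : SpecialLinearGroup (Fin 2) F) = 1 := (ofSL_eq_one_iff _).mpr (Or.inr rfl)
  have hcomm : ofSL x * ofSL y = ofSL y * ofSL x := by
    rw [← map_mul, hxy, ← neg_one_mul, map_mul, hneg, one_mul, map_mul]
  have hxy_sq : (x * y) * (x * y) = -1 := by
    calc (x * y) * (x * y) = -(y * x) * (x * y) := by rw [← hxy]
      _ = -(y * (x * x) * y) := by simp only [neg_mul, mul_assoc]
      _ = -1 := by simp [hx, hy]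
  refine ⟨_, isKleinFour_kleinFourSubgroup (hsq hx) (hsq hy) hcomm (hne1 hx) (hne1 hy) fun h => ?_⟩
  refine hne1 hxy_sq ?_
  rw [map_mul, ← h, hsq hx]

end PSL2

/-- For an odd prime power `q`, the `2`-rank of `PSL₂(q)` is `2`: every elementary
abelian `2`-subgroup has order at most `4`, and there is a subgroup isomorphic to
`ℤ/2ℤ × ℤ/2ℤ`. -/
theorem pRank_two_PSL2 (q : ℕ) (hq : IsPrimePow q) (hodd : Odd q)
    (F : Type*) [Field F] [Fintype F] (hF : Fintype.card F = q) :
    pRank 2 (PSL2 F) = 2 ∧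
    (∀ H : Subgroup (PSL2 F), IsElementaryAbelian 2 H → Nat.card H ≤ 4) ∧
    (∃ H : Subgroup (PSL2 F), Nonempty (H ≃* Multiplicative (ZMod 2 × ZMod 2))) := by
  have h2 : (2 : F) ≠ 0 := by
    intro h
    have hdvd : ringChar F ∣ 2 := ringChar.dvd (by exact_mod_cast h)
    have := FiniteField.even_card_of_char_two
      (((Nat.dvd_prime Nat.prime_two).mp hdvd).resolve_left CharP.ringChar_ne_one)
    rw [hF] at this
    grind
  have hcard : ∀ H : Subgroup (PSL2 F), IsElementaryAbelian 2 H → Nat.card H ≤ 4 := by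
    rintro H ⟨n, ⟨e⟩⟩
    refine PSL2.card_le_four h2 H (fun x hx => ?_) (fun x hx y hy => ?_)
    · suffices (⟨x, hx⟩ * ⟨x, hx⟩ : H) = 1 from congrArg Subtype.val this
      apply e.injective
      rw [map_mul, map_one]
      exact congrArg Multiplicative.ofAdd (funext fun i => CharTwo.add_self_eq_zero _)
    · suffices (⟨x, hx⟩ * ⟨y, hy⟩ : H) = ⟨y, hy⟩ * ⟨x, hx⟩ from congrArg Subtype.val this
      apply e.injective
      rw [map_mul, map_mul, mul_comm]
  obtain ⟨K, hK⟩ := PSL2.exists_isKleinFour h2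
  have hKlein : Nonempty (K ≃* Multiplicative (ZMod 2 × ZMod 2)) := IsKleinFour.nonempty_mulEquiv
  refine ⟨IsGreatest.csSup_eq ⟨⟨K, ?_⟩, ?_⟩, hcard, K, hKlein⟩
  · obtain ⟨e⟩ := hKlein
    exact ⟨e.trans (AddEquiv.toMultiplicative
      (LinearEquiv.finTwoArrow (ZMod 2) (ZMod 2)).symm.toAddEquiv)⟩
  · rintro n ⟨H, ⟨e⟩⟩
    have h4 := hcard H ⟨n, ⟨e⟩⟩
    rw [Nat.card_congr e.toEquiv] at h4
    simp at h4
    exact (Nat.pow_le_pow_iff_right (le_refl 2)).mp h4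
end

section
/- Let q be an odd prime power. Then the 2-ranks of PSL_3(q) and of PGL_3(q) both equal 2; that is, every elementary abelian 2-subgroup of PGL_3(q) (and hence of PSL_3(q)) has order at most 4, and PSL_3(q) contains a subgroup isomorphic to ℤ/2ℤ × ℤ/2ℤ. -/
/-- `PGL₃(F)`: the quotient of `GL(3,F)` by its center. -/
abbrev PGL3 (F : Type*) [Field F] :=
  Matrix.GeneralLinearGroup (Fin 3) F ⧸ Subgroup.center (Matrix.GeneralLinearGroup (Fin 3) F)

/-- `PSL₃(F)`: the image of `SL(3,F)` in `PGL₃(F)` under the natural map. -/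
def PSL3 (F : Type*) [Field F] : Subgroup (PGL3 F) :=
  ((QuotientGroup.mk' (Subgroup.center (Matrix.GeneralLinearGroup (Fin 3) F))).comp
    Matrix.SpecialLinearGroup.toGL).range

/-- The Cayley–Hamilton identity for a `3 × 3` matrix, multiplied by two so that the second
coefficient can be written in terms of traces. -/
theorem Matrix.two_mul_cayleyHamilton_three {R : Type*} [CommRing R]
    (A : Matrix (Fin 3) (Fin 3) R) :
    (2 : R) • (A * A * A) - (2 * A.trace) • (A * A) + (A.trace ^ 2 - (A * A).trace) • A
      - (2 * A.det) • (1 : Matrix (Fin 3) (Fin 3) R) = 0 := by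
  ext i j
  fin_cases i <;> fin_cases j <;>
    simp [Matrix.mul_apply, Matrix.trace, Fin.sum_univ_three, Matrix.det_fin_three] <;> ring

section Involutions

variable {F : Type*} [Field F]

/-- A nontrivial involution in `SL₃` has trace `-1`. -/
theorem Matrix.trace_eq_neg_one_of_mul_self_eq_one (h2 : (2 : F) ≠ 0)
    {A : Matrix (Fin 3) (Fin 3) F} (hA : A * A = 1) (hdet : A.det = 1) (hne : A ≠ 1) :
    A.trace = -1 := by
  have ch := A.two_mul_cayleyHamilton_three
  rw [hA, one_mul, hdet, Matrix.trace_one, Fintype.card_fin] at ch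
  push_cast at ch
  set t := A.trace
  by_contra ht
  have ht' : t + 1 ≠ 0 := fun h => ht (by linear_combination h)
  have h1 : (t - 1) • A = (2 : F) • (1 : Matrix (Fin 3) (Fin 3) F) := by
    refine smul_right_injective _ ht' (?_ : (t + 1) • (t - 1) • A = (t + 1) • (2 : F) • 1)
    linear_combination (norm := module) ch
  have h3 : ((t - 1) * (t - 1)) • (1 : Matrix (Fin 3) (Fin 3) F) = ((2 : F) * 2) • 1 := by
    have h := congrArg₂ (· * ·) h1 h1
    simpa only [smul_mul_smul_comm, hA, mul_one] using h
  have h4 : (t - 1) * (t - 1) = 2 * 2 := by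
    simpa using congrFun (congrFun h3 0) 0
  have h5 : t - 1 = 2 := by
    have : (t + 1) * (t - 3) = 0 := by linear_combination h4
    linear_combination (mul_eq_zero.mp this).resolve_left ht'
  rw [h5] at h1
  exact hne (smul_right_injective _ h2 h1)

/-- Up to scaling by four, an idempotent `3 × 3` matrix of trace zero is `0` or `1`. -/
theorem Matrix.eq_zero_or_eq_four_of_trace_eq_zero (h2 : (2 : F) ≠ 0)
    {S : Matrix (Fin 3) (Fin 3) F} (hS : S * S = (4 : F) • S) (htr : S.trace = 0) :
    S = 0 ∨ S = (4 : F) • 1 := by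
  have h4 : (4 : F) ≠ 0 := by
    have := mul_ne_zero h2 h2
    norm_num at this
    exact this
  have ch := S.two_mul_cayleyHamilton_three
  rw [hS, Matrix.trace_smul, htr, smul_mul_assoc, hS] at ch
  by_cases hd : S.det = 0
  · left
    rw [hd] at ch
    have : ((2 * 4) * 4 : F) • S = 0 := by simpa [smul_smul, mul_assoc] using ch
    exact (smul_eq_zero.mp this).resolve_left (mul_ne_zero (mul_ne_zero h2 h4) h4)
  · right
    have hu : IsUnit S := (Matrix.isUnit_iff_isUnit_det S).mpr (isUnit_iff_ne_zero.mpr hd)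
    apply hu.mul_left_cancel
    rw [hS, mul_smul_comm, mul_one]

/-- Two distinct commuting nontrivial involutions of `SL₃` satisfy `1 + A + B + AB = 0`. -/
theorem Matrix.mul_eq_of_commute_of_mul_self_eq_one (h2 : (2 : F) ≠ 0)
    {A B : Matrix (Fin 3) (Fin 3) F} (hA : A * A = 1) (hB : B * B = 1) (hAdet : A.det = 1)
    (hBdet : B.det = 1) (hA1 : A ≠ 1) (hB1 : B ≠ 1) (hne : A ≠ B) (hAB : A * B = B * A) :
    A * B = -1 - A - B := by
  have hBA : B * (A * B) = A := by rw [hAB, ← mul_assoc, hB, one_mul]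
  have hAAB : A * (A * B) = B := by rw [← mul_assoc, hA, one_mul]
  have hC : (A * B) * (A * B) = 1 := by rw [mul_assoc, hBA, hA]
  have hC1 : A * B ≠ 1 := fun h => hne (by rw [h, mul_one] at hAAB; exact hAAB)
  have htr : (1 + A + B + A * B).trace = 0 := by
    simp only [Matrix.trace_add, Matrix.trace_one, Fintype.card_fin,
      Matrix.trace_eq_neg_one_of_mul_self_eq_one h2 hA hAdet hA1,
      Matrix.trace_eq_neg_one_of_mul_self_eq_one h2 hB hBdet hB1,
      Matrix.trace_eq_neg_one_of_mul_self_eq_one h2 hC (by simp [hAdet, hBdet]) hC1]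
    norm_num
  have hAS : A * (1 + A + B + A * B) = 1 + A + B + A * B := by
    simp only [mul_add, mul_one, hA, hAAB]; abel
  have hBS : B * (1 + A + B + A * B) = 1 + A + B + A * B := by
    simp only [mul_add, mul_one, hB, hBA, ← hAB]; abel
  have hSS : (1 + A + B + A * B) * (1 + A + B + A * B) = (4 : F) • (1 + A + B + A * B) := by
    conv_lhs => rw [add_mul, add_mul, add_mul, one_mul, mul_assoc A B, hBS, hAS]
    module
  rcases Matrix.eq_zero_or_eq_four_of_trace_eq_zero h2 hSS htr with h | h
  · linear_combination (norm := module) h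
  · rw [h, mul_smul_comm, mul_one] at hAS
    have h4 : (4 : F) ≠ 0 := by
      have := mul_ne_zero h2 h2
      norm_num at this
      exact this
    exact absurd (smul_right_injective _ h4 hAS) hA1

/-- A commuting triple of involutions of `SL₃` cannot be independent. -/
theorem Matrix.eq_mul_of_commute_of_mul_self_eq_one (h2 : (2 : F) ≠ 0)
    {A B C : Matrix (Fin 3) (Fin 3) F} (hA : A * A = 1) (hB : B * B = 1) (hC : C * C = 1)
    (hAdet : A.det = 1) (hBdet : B.det = 1) (hCdet : C.det = 1)
    (hAB : A * B = B * A) (hAC : A * C = C * A) (hBC : B * C = C * B)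
    (hA1 : A ≠ 1) (hB1 : B ≠ 1) (hBA : A ≠ B) (hC1 : C ≠ 1) (hCA : A ≠ C) (hCB : B ≠ C) :
    A * B = C := by
  by_contra hne
  have e1 := mul_eq_of_commute_of_mul_self_eq_one h2 hA hB hAdet hBdet hA1 hB1 hBA hAB
  have e2 := mul_eq_of_commute_of_mul_self_eq_one h2 hA hC hAdet hCdet hA1 hC1 hCA hAC
  have e3 := mul_eq_of_commute_of_mul_self_eq_one h2 hB hC hBdet hCdet hB1 hC1 hCB hBC
  have hD : (A * B) * (A * B) = 1 := by
    rw [mul_assoc, hAB, ← mul_assoc B, hB, one_mul, hA]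
  have hD1 : A * B ≠ 1 := fun h => hBA <| by
    have : A * (A * B) = B := by rw [← mul_assoc, hA, one_mul]
    rwa [h, mul_one] at this
  have e4 := mul_eq_of_commute_of_mul_self_eq_one h2 hD hC (by simp [hAdet, hBdet]) hCdet hD1 hC1
    hne (by rw [mul_assoc, hBC, ← mul_assoc, hAC, mul_assoc])
  rw [mul_assoc, e3, mul_sub, mul_sub, mul_neg, mul_one, e1, e2] at e4
  have h : (2 : F) • C = (2 : F) • (-1) := by linear_combination (norm := module) e4
  have hC' : C = -1 := smul_right_injective _ h2 h
  rw [hC', Matrix.det_neg, Matrix.det_one, Fintype.card_fin] at hCdet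
  exact h2 (by linear_combination -hCdet)

end Involutions

section PGL

variable {F : Type*} [Field F]

theorem PGL3.mk_eq_mk_iff {A B : Matrix.GeneralLinearGroup (Fin 3) F} :
    (A : PGL3 F) = B ↔ ∃ c : Fˣ, (B : Matrix (Fin 3) (Fin 3) F) = (c : F) • A.val := by
  rw [QuotientGroup.eq, Matrix.GeneralLinearGroup.center_eq_range_scalar]
  constructor
  · rintro ⟨c, hc⟩
    refine ⟨c, ?_⟩
    have : B = A * Matrix.GeneralLinearGroup.scalar (Fin 3) c := by rw [hc]; group
    rw [this]
    ext i j
    simp [mul_comm]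
  · rintro ⟨c, hc⟩
    refine ⟨c, ?_⟩
    rw [eq_inv_mul_iff_mul_eq]
    ext i j
    simp [hc, mul_comm]

/-- Every involution of `PGL₃` lifts to an involution of determinant one. -/
theorem PGL3.exists_lift_of_mul_self_eq_one {g : PGL3 F} (hg : g * g = 1) :
    ∃ A : Matrix.GeneralLinearGroup (Fin 3) F, (A : PGL3 F) = g ∧ A.val * A.val = 1 ∧
      A.val.det = 1 := by
  obtain ⟨A, rfl⟩ := QuotientGroup.mk_surjective g
  rw [← QuotientGroup.mk_mul, ← QuotientGroup.mk_one, eq_comm, PGL3.mk_eq_mk_iff] at hg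
  obtain ⟨c, hc⟩ := hg
  simp only [Units.val_mul, Units.val_one] at hc
  have hdet : A.val.det * A.val.det = (c : F) ^ 3 := by
    simpa using congrArg Matrix.det hc
  let d : Fˣ := Matrix.GeneralLinearGroup.det A
  have hd : (d : F) = A.val.det := rfl
  rw [← hd] at hdet
  let s : Fˣ := d⁻¹ * c
  have hs : (s : F) = (d : F)⁻¹ * c := by simp [s]
  have hs2 : (s * s * c : F) = 1 := by
    rw [hs]
    field_simp
    linear_combination -hdet
  have hs3 : (s ^ 3 * d : F) = 1 := by
    rw [hs]
    field_simp
    linear_combination -hdet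
  refine ⟨A * Matrix.GeneralLinearGroup.scalar (Fin 3) s, ?_, ?_, ?_⟩
  all_goals
    have hv : (A * Matrix.GeneralLinearGroup.scalar (Fin 3) s).val = (s : F) • A.val := by
      ext i j
      simp [mul_comm]
  · exact (PGL3.mk_eq_mk_iff.mpr ⟨s, hv⟩).symm
  · rw [hv, smul_mul_smul_comm, hc, smul_smul]
    rw [hs2, one_smul]
  · rw [hv, Matrix.det_smul, Fintype.card_fin, ← hd, hs3]

theorem PGL3.lift_commute {A B : Matrix.GeneralLinearGroup (Fin 3) F}
    (hA : A.val * A.val = 1) (hB : B.val * B.val = 1)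
    (hAB : (A : PGL3 F) * B = B * A) : A.val * B.val = B.val * A.val := by
  rw [← QuotientGroup.mk_mul, ← QuotientGroup.mk_mul, eq_comm, PGL3.mk_eq_mk_iff] at hAB
  obtain ⟨c, hc⟩ := hAB
  simp only [Units.val_mul] at hc
  have h3 : (c : F) ^ 3 = 1 := by
    have h := congrArg Matrix.det hc
    rw [Matrix.det_smul, Matrix.det_mul, Matrix.det_mul, Fintype.card_fin] at h
    have hA0 : A.val.det ≠ 0 := (Matrix.GeneralLinearGroup.det A).ne_zero
    have hB0 : B.val.det ≠ 0 := (Matrix.GeneralLinearGroup.det B).ne_zero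
    apply mul_right_cancel₀ (mul_ne_zero hA0 hB0)
    linear_combination -h
  have h2 : (c : F) ^ 2 = 1 := by
    have h : A.val * (A.val * B.val) = ((c : F) ^ 2) • B.val := by
      rw [hc, mul_smul_comm, ← mul_assoc, hc, smul_mul_assoc, smul_smul, mul_assoc, hA, mul_one,
        sq]
    rw [← mul_assoc, hA, one_mul] at h
    have h' := congrArg (· * B.val) h
    simp only [smul_mul_assoc, hB] at h'
    simpa using (congrFun (congrFun h' 0) 0).symm
  have hc1 : (c : F) = 1 := by linear_combination h3 - (c : F) * h2
  rw [hc, hc1, one_smul]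

/-- A subgroup of `PGL₃` of exponent dividing two has order at most four in odd characteristic. -/
theorem PGL3.card_le_four (h2 : (2 : F) ≠ 0) (H : Subgroup (PGL3 F))
    (hH : ∀ g ∈ H, g * g = 1) : Nat.card H ≤ 4 := by
  classical
  have hcomm : ∀ a ∈ H, ∀ b ∈ H, a * b = b * a := fun a ha b hb => by
    have h := hH _ (H.mul_mem ha hb)
    calc a * b = (a * b)⁻¹ := eq_inv_of_mul_eq_one_left h
      _ = b⁻¹ * a⁻¹ := mul_inv_rev a b
      _ = b * a := by
        rw [← eq_inv_of_mul_eq_one_left (hH a ha), ← eq_inv_of_mul_eq_one_left (hH b hb)]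
  by_contra! hcard
  have hfin : Finite H := Nat.finite_of_card_ne_zero (by omega)
  have := Fintype.ofFinite H
  have avoid : ∀ s : Finset H, s.card ≤ 4 → ∃ x, x ∉ s := fun s hs => by
    by_contra! h
    rw [Nat.card_eq_fintype_card, ← Finset.card_univ, ← Finset.eq_univ_of_forall h] at hcard
    omega
  obtain ⟨⟨a, ha⟩, ha'⟩ := avoid {1} (by simp)
  obtain ⟨⟨b, hb⟩, hb'⟩ := avoid {1, ⟨a, ha⟩} (Finset.card_le_two.trans (by norm_num))
  obtain ⟨⟨c, hc⟩, hc'⟩ := avoid {1, ⟨a, ha⟩, ⟨b, hb⟩, ⟨a, ha⟩ * ⟨b, hb⟩} Finset.card_le_four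
  obtain ⟨A, rfl, hA, hAd⟩ := exists_lift_of_mul_self_eq_one (hH a ha)
  obtain ⟨B, rfl, hB, hBd⟩ := exists_lift_of_mul_self_eq_one (hH b hb)
  obtain ⟨C, rfl, hC, hCd⟩ := exists_lift_of_mul_self_eq_one (hH c hc)
  simp only [Finset.mem_insert, Finset.mem_singleton, not_or, Subtype.ext_iff, Subgroup.coe_one,
    Subgroup.coe_mul] at ha' hb' hc'
  have ne : ∀ {X Y : Matrix.GeneralLinearGroup (Fin 3) F}, (X : PGL3 F) ≠ Y → X.val ≠ Y.val :=
    fun h e => h (congrArg _ (Units.ext e))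
  refine hc'.2.2.2 ?_
  rw [← QuotientGroup.mk_mul]
  refine congrArg _ (Units.ext ?_)
  exact (Matrix.eq_mul_of_commute_of_mul_self_eq_one h2 hA hB hC hAd hBd hCd
    (lift_commute hA hB (hcomm _ ha _ hb)) (lift_commute hA hC (hcomm _ ha _ hc))
    (lift_commute hB hC (hcomm _ hb _ hc)) (ne (Y := 1) ha') (ne (Y := 1) hb'.1)
    (ne (Ne.symm hb'.2)) (ne (Y := 1) hc'.1) (ne (Ne.symm hc'.2.1)) (ne (Ne.symm hc'.2.2.1))).symm

end PGL

section Diagonal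

variable (F : Type*) [Field F]

/-- The diagonal matrices `diag(u, v, uv)` with `u, v = ±1`, as a homomorphism to `SL₃`. -/
def signDiagonal : ℤˣ × ℤˣ →* Matrix.SpecialLinearGroup (Fin 3) F where
  toFun u := ⟨Matrix.diagonal ![((u.1 : ℤ) : F), ((u.2 : ℤ) : F), ((u.1 * u.2 : ℤ) : F)], by
    rw [Matrix.det_diagonal, Fin.prod_univ_three]
    rcases u with ⟨u, v⟩
    rcases Int.units_eq_one_or u with rfl | rfl <;> rcases Int.units_eq_one_or v with rfl | rfl <;>
      simp⟩
  map_one' := by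
    ext i j
    fin_cases i <;> fin_cases j <;> simp
  map_mul' u v := by
    apply Subtype.ext
    change Matrix.diagonal _ = Matrix.diagonal _ * Matrix.diagonal _
    rw [Matrix.diagonal_mul_diagonal]
    congr 1
    ext i
    fin_cases i <;> simp [mul_mul_mul_comm]

theorem coe_signDiagonal (u : ℤˣ × ℤˣ) :
    (signDiagonal F u : Matrix (Fin 3) (Fin 3) F) =
      Matrix.diagonal ![((u.1 : ℤ) : F), ((u.2 : ℤ) : F), ((u.1 * u.2 : ℤ) : F)] :=
  rfl

/-- The homomorphism from `ℤˣ × ℤˣ` to `PSL₃` given by diagonal matrices. -/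
def signDiagonalPSL3 : ℤˣ × ℤˣ →* PSL3 F :=
  ((QuotientGroup.mk' (Subgroup.center (Matrix.GeneralLinearGroup (Fin 3) F))).comp
    Matrix.SpecialLinearGroup.toGL).rangeRestrict.comp (signDiagonal F)

variable {F}

theorem signDiagonalPSL3_injective (h2 : (2 : F) ≠ 0) :
    Function.Injective (signDiagonalPSL3 F) := by
  rw [injective_iff_map_eq_one]
  rintro ⟨u, v⟩ h
  have h' : ((Matrix.SpecialLinearGroup.toGL (signDiagonal F (u, v)) :
      Matrix.GeneralLinearGroup (Fin 3) F) : PGL3 F) = (1 : Matrix.GeneralLinearGroup (Fin 3) F) :=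
    congrArg Subtype.val h
  rw [eq_comm, PGL3.mk_eq_mk_iff] at h'
  obtain ⟨c, hc⟩ := h'
  have e0 : ((u : ℤ) : F) = c := by simpa [coe_signDiagonal] using congrFun (congrFun hc 0) 0
  have e1 : ((v : ℤ) : F) = c := by simpa [coe_signDiagonal] using congrFun (congrFun hc 1) 1
  have e2 : ((u : ℤ) : F) * (v : ℤ) = c := by
    simpa [coe_signDiagonal] using congrFun (congrFun hc 2) 2
  have hne : (1 : F) ≠ -1 := fun e => h2 (by linear_combination e)
  clear h hc
  rcases Int.units_eq_one_or u with rfl | rfl <;> rcases Int.units_eq_one_or v with rfl | rfl <;>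
    simp_all

end Diagonal

theorem exists_mulEquiv_of_injective {G K : Type*} [Group G] [Group K] {f : G →* K}
    (hf : Function.Injective f) {L : Type*} [Group L] (e : G ≃* L) :
    ∃ H : Subgroup K, Nonempty (H ≃* L) :=
  ⟨f.range, ⟨(MonoidHom.ofInjective hf).symm.trans e⟩⟩

theorem pRank_eq_two {G : Type*} [Group G]
    (hle : ∀ H : Subgroup G, IsElementaryAbelian 2 H → Nat.card H ≤ 4)
    (hex : ∃ H : Subgroup G, Nonempty (H ≃* Multiplicative (ZMod 2 × ZMod 2))) :
    pRank 2 G = 2 := by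
  refine IsGreatest.csSup_eq ⟨?_, ?_⟩
  · obtain ⟨H, ⟨e⟩⟩ := hex
    exact ⟨H, ⟨e.trans
      (LinearEquiv.finTwoArrow (ZMod 2) (ZMod 2)).symm.toAddEquiv.toMultiplicative⟩⟩
  · rintro n ⟨H, ⟨e⟩⟩
    have h := hle H ⟨n, ⟨e⟩⟩
    rw [Nat.card_congr (e.toEquiv.trans Multiplicative.toAdd)] at h
    simp only [Nat.card_eq_fintype_card, Fintype.card_pi, ZMod.card, Finset.prod_const,
      Finset.card_univ, Fintype.card_fin] at h
    exact (Nat.pow_le_pow_iff_right (by norm_num : 1 < 2)).mp h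

theorem IsElementaryAbelian.mul_self_eq_one {G : Type*} [Group G] {H : Subgroup G}
    (hH : IsElementaryAbelian 2 H) {g : G} (hg : g ∈ H) : g * g = 1 := by
  obtain ⟨n, ⟨e⟩⟩ := hH
  have h : (⟨g, hg⟩ * ⟨g, hg⟩ : H) = 1 := by
    apply e.injective
    rw [map_mul, map_one]
    apply Multiplicative.toAdd.injective
    funext i
    exact CharTwo.add_self_eq_zero _
  exact congrArg Subtype.val h

/-- For an odd prime power `q`, the `2`-ranks of `PSL₃(q)` and `PGL₃(q)` both equal
`2`: every elementary abelian `2`-subgroup of `PGL₃(q)` (hence of `PSL₃(q)`) has order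
at most `4`, and `PSL₃(q)` contains a subgroup isomorphic to `ℤ/2ℤ × ℤ/2ℤ`. -/
theorem pRank_two_PSL3_PGL3 (q : ℕ) (hq : IsPrimePow q) (hodd : Odd q)
    (F : Type*) [Field F] [Fintype F] (hF : Fintype.card F = q) :
    pRank 2 (PSL3 F) = 2 ∧ pRank 2 (PGL3 F) = 2 ∧
    (∀ H : Subgroup (PGL3 F), IsElementaryAbelian 2 H → Nat.card H ≤ 4) ∧
    (∃ H : Subgroup (PSL3 F), Nonempty (H ≃* Multiplicative (ZMod 2 × ZMod 2))) := by
  have h2 : (2 : F) ≠ 0 := by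
    apply Ring.two_ne_zero
    intro h
    have := FiniteField.even_card_iff_char_two.mp h
    rw [hF] at this
    exact Nat.not_even_iff_odd.mpr hodd (Nat.even_iff.mpr this)
  have hPGL : ∀ H : Subgroup (PGL3 F), IsElementaryAbelian 2 H → Nat.card H ≤ 4 :=
    fun H hH => PGL3.card_le_four h2 H fun _ hg => hH.mul_self_eq_one hg
  have hPSL : ∀ H : Subgroup (PSL3 F), IsElementaryAbelian 2 H → Nat.card H ≤ 4 := by
    rintro H ⟨n, ⟨e⟩⟩
    let f := H.equivMapOfInjective (PSL3 F).subtype (PSL3 F).subtype_injective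
    rw [Nat.card_congr f.toEquiv]
    exact hPGL _ ⟨n, ⟨f.symm.trans e⟩⟩
  have : Nontrivial (ℤˣ × ℤˣ) := ⟨1, (-1, 1), by decide⟩
  have : IsKleinFour (ℤˣ × ℤˣ) :=
    { card_four := by simp [Nat.card_eq_fintype_card]
      exponent_two := (Monoid.exponent_eq_prime_iff Nat.prime_two).mpr fun g hg =>
        orderOf_eq_prime (by revert g; decide) hg }
  have e : ℤˣ × ℤˣ ≃* Multiplicative (ZMod 2 × ZMod 2) := IsKleinFour.nonempty_mulEquiv.some
  have hex := exists_mulEquiv_of_injective (signDiagonalPSL3_injective h2) e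
  have hex' := exists_mulEquiv_of_injective
    (f := (PSL3 F).subtype.comp (signDiagonalPSL3 F))
    ((PSL3 F).subtype_injective.comp (signDiagonalPSL3_injective h2)) e
  exact ⟨pRank_eq_two hPSL hex, pRank_eq_two hPGL hex', hPGL, hex⟩
end

section
/- Let q be an odd prime power and let ε ∈ {1,-1} be such that q ≡ ε (mod 4). Then the number of involutions of PSL_2(q) is q(q+ε)/2. -/
open Matrix

/-- The preimage of a set under a surjective homomorphism has the size of the set times that of the
kernel. -/
theorem MonoidHom.card_preimage_of_surjective {G H : Type*} [Group G] [Group H] (f : G →* H)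
    (hf : Function.Surjective f) (t : Set H) :
    Nat.card (f ⁻¹' t) = Nat.card f.ker * Nat.card t := by
  let e := QuotientGroup.quotientKerEquivOfSurjective f hf
  have ht : Nat.card (e ⁻¹' t) = Nat.card t :=
    Nat.card_preimage_of_injective e.injective (by simp [e.surjective.range_eq])
  rw [← ht]
  exact QuotientGroup.card_preimage_mk f.ker (e ⁻¹' t)

namespace PSL2

variable {F : Type*} [Field F]

/-- The natural surjection from `SL(2,F)` to `PSL₂(F)`. -/
def proj (F : Type*) [Field F] : Matrix.SpecialLinearGroup (Fin 2) F →* PSL2 F :=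
  ((QuotientGroup.mk' (Subgroup.center (Matrix.GeneralLinearGroup (Fin 2) F))).comp
    Matrix.SpecialLinearGroup.toGL).rangeRestrict

theorem proj_surjective : Function.Surjective (proj F) :=
  MonoidHom.rangeRestrict_surjective _

theorem proj_eq_one_iff (g : Matrix.SpecialLinearGroup (Fin 2) F) :
    proj F g = 1 ↔ g = 1 ∨ g = -1 := by
  have h : proj F g = 1 ↔ Matrix.SpecialLinearGroup.toGL g ∈
      Subgroup.center (Matrix.GeneralLinearGroup (Fin 2) F) := by
    rw [← QuotientGroup.eq_one_iff, Subtype.ext_iff]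
    rfl
  rw [h, Matrix.GeneralLinearGroup.mem_center_iff_val_mem_range_scalar]
  constructor
  · rintro ⟨a, ha⟩
    have hg : (g : Matrix (Fin 2) (Fin 2) F) = scalar (Fin 2) a := ha.symm
    have hdet := g.det_coe
    rw [hg] at hdet
    have ha : a = 1 ∨ a = -1 := by simpa using hdet
    refine ha.imp ?_ ?_ <;> rintro rfl <;> ext i j <;> rw [hg] <;>
      fin_cases i <;> fin_cases j <;> simp
  · rintro (rfl | rfl)
    · exact ⟨1, by simp⟩
    · exact ⟨-1, by ext i j; fin_cases i <;> fin_cases j <;> simp⟩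

theorem card_ker_proj (h2 : (2 : F) ≠ 0) : Nat.card (proj F).ker = 2 := by
  have h : ((proj F).ker : Set (Matrix.SpecialLinearGroup (Fin 2) F)) = {1, -1} := by
    ext g
    simpa using proj_eq_one_iff g
  have hne : (1 : Matrix.SpecialLinearGroup (Fin 2) F) ≠ -1 := by
    intro he
    have := congrArg (fun g : Matrix.SpecialLinearGroup (Fin 2) F => g 0 0) he
    simp only [Matrix.SpecialLinearGroup.coe_one, Matrix.SpecialLinearGroup.coe_neg, Matrix.neg_apply,
      Matrix.one_apply_eq] at this
    exact h2 (by linear_combination this)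
  change Nat.card ((proj F).ker : Set (Matrix.SpecialLinearGroup (Fin 2) F)) = 2
  rw [h, Nat.card_coe_set_eq, Set.ncard_pair hne]

theorem orderOf_proj_eq_two_iff (h2 : (2 : F) ≠ 0) (g : Matrix.SpecialLinearGroup (Fin 2) F) :
    orderOf (proj F g) = 2 ↔ g 0 0 + g 1 1 = 0 := by
  rw [orderOf_eq_prime_iff, ← map_pow, ne_eq, proj_eq_one_iff, proj_eq_one_iff]
  have hdet := g.det_coe
  rw [Matrix.det_fin_two] at hdet
  simp only [Matrix.SpecialLinearGroup.ext_iff, Fin.forall_fin_two, pow_two, Matrix.SpecialLinearGroup.coe_mul,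
    Matrix.mul_apply, Fin.sum_univ_two, Matrix.SpecialLinearGroup.coe_one, Matrix.SpecialLinearGroup.coe_neg,
    Matrix.neg_apply, Matrix.one_apply_eq, Matrix.one_apply_ne, ne_eq, zero_ne_one, one_ne_zero,
    not_false_eq_true, neg_zero]
  generalize g 0 0 = a at *
  generalize g 0 1 = b at *
  generalize g 1 0 = c at *
  generalize g 1 1 = d at *
  constructor
  · rintro ⟨hsq, hne⟩
    by_contra ht
    have hb : b = 0 := by
      have : (a + d) * b = 0 := by
        rcases hsq with h | h <;> linear_combination h.1.2
      exact (mul_eq_zero.mp this).resolve_left ht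
    have hc : c = 0 := by
      have : (a + d) * c = 0 := by
        rcases hsq with h | h <;> linear_combination h.2.1
      exact (mul_eq_zero.mp this).resolve_left ht
    subst hb hc
    have had : a = d := by
      have : (a + d) * (a - d) = 0 := by
        rcases hsq with h | h <;> linear_combination h.1.1 - h.2.2
      exact sub_eq_zero.mp ((mul_eq_zero.mp this).resolve_left ht)
    subst had
    have ha : a = 1 ∨ a = -1 := mul_self_eq_one_iff.mp (by linear_combination hdet)
    exact hne (by simpa using ha)
  · intro ht
    obtain rfl : d = -a := by linear_combination ht
    refine ⟨Or.inr ⟨⟨?_, ?_⟩, ?_, ?_⟩, ?_⟩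
    · linear_combination -hdet
    · ring
    · ring
    · linear_combination -hdet
    · rintro (h | h)
      · exact h2 (by linear_combination -h.1.1 - h.2.2)
      · exact h2 (by linear_combination h.1.1 + h.2.2)

end PSL2

/-- Traceless matrices of determinant one, sorted by whether the upper right entry vanishes. -/
noncomputable def Matrix.SpecialLinearGroup.tracelessEquiv (F : Type*) [Field F] :
    {g : Matrix.SpecialLinearGroup (Fin 2) F // g 0 0 + g 1 1 = 0} ≃
      (Fˣ × F) ⊕ ({a : F // a ^ 2 = -1} × F) := by
  classical
  refine
    { toFun := fun g =>
        if h : g.1 0 1 = 0 then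
          Sum.inr (⟨g.1 0 0, ?_⟩, g.1 1 0)
        else Sum.inl (Units.mk0 _ h, g.1 0 0)
      invFun := Sum.elim
        (fun p => ⟨⟨!![p.2, p.1; -(1 + p.2 ^ 2) / p.1, -p.2], ?_⟩, ?_⟩)
        (fun p => ⟨⟨!![p.1, 0; p.2, -p.1], ?_⟩, ?_⟩)
      left_inv := ?_
      right_inv := ?_ }
  · have hdet := g.1.det_coe
    rw [Matrix.det_fin_two, h] at hdet
    linear_combination (g.1 0 0) * g.2 - hdet
  · have := p.1.ne_zero
    rw [Matrix.det_fin_two_of]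
    field_simp
    ring
  · simp
  · rw [Matrix.det_fin_two_of]
    linear_combination -p.1.2
  · simp
  · rintro ⟨g, hg⟩
    have hdet := g.det_coe
    rw [Matrix.det_fin_two] at hdet
    have hd : g 1 1 = -g 0 0 := by linear_combination hg
    by_cases h : g 0 1 = 0
    · ext i j
      fin_cases i <;> fin_cases j <;> simp [h, hd]
    · ext i j
      fin_cases i <;> fin_cases j <;> simp [h, hd]
      rw [hd] at hdet
      field_simp
      linear_combination hdet
  · rintro (⟨b, a⟩ | ⟨a, c⟩)
    · simp
    · simp

/-- The number of square roots of `-1` in a finite field of order congruent to `±1` modulo `4`. -/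
theorem card_sqrt_neg_one {F : Type*} [Field F] [Fintype F] (h2 : (2 : F) ≠ 0) {ε : ℤ}
    (hε : ε = 1 ∨ ε = -1) (hmod : (Fintype.card F : ℤ) ≡ ε [ZMOD 4]) :
    (Nat.card {a : F // a ^ 2 = -1} : ℤ) = ε + 1 := by
  classical
  have hchar : ringChar F ≠ 2 := fun h => h2 (by
    have := ringChar.Nat.cast_ringChar (R := F)
    rw [h] at this
    exact_mod_cast this)
  have h := quadraticChar_card_sqrts hchar (-1)
  have hχ : ZMod.χ₄ (Fintype.card F) = ε := by
    rw [Int.ModEq] at hmod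
    rcases hε with rfl | rfl
    · exact ZMod.χ₄_nat_one_mod_four (by omega)
    · exact ZMod.χ₄_nat_three_mod_four (by omega)
  rw [quadraticChar_neg_one hchar, hχ, Set.toFinset_card, ← Nat.card_eq_fintype_card] at h
  exact h

/-- For an odd prime power `q` with `q ≡ ε (mod 4)`, `ε = ±1`, the number of
involutions of `PSL₂(q)` is `q(q+ε)/2`. -/
theorem card_involutions_PSL2 (q : ℕ) (hq : IsPrimePow q) (hodd : Odd q)
    (ε : ℤ) (hε : ε = 1 ∨ ε = -1) (hmod : (q : ℤ) ≡ ε [ZMOD 4])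
    (F : Type*) [Field F] [Fintype F] (hF : Fintype.card F = q) :
    2 * (Nat.card {t : PSL2 F // orderOf t = 2} : ℤ) = q * (q + ε) := by
  have h2 : (2 : F) ≠ 0 := by
    refine Ring.two_ne_zero fun h => ?_
    have := FiniteField.even_card_iff_char_two.mp h
    rw [hF] at this
    have := Nat.odd_iff.mp hodd
    omega
  subst hF
  have h := (PSL2.proj F).card_preimage_of_surjective PSL2.proj_surjective {t | orderOf t = 2}
  have he : PSL2.proj F ⁻¹' {t | orderOf t = 2} = {g | g 0 0 + g 1 1 = 0} := by
    ext g
    exact PSL2.orderOf_proj_eq_two_iff h2 g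
  rw [he, PSL2.card_ker_proj h2] at h
  have hc := Nat.card_congr (Matrix.SpecialLinearGroup.tracelessEquiv F)
  rw [Nat.card_sum, Nat.card_prod, Nat.card_prod, Nat.card_units] at hc
  have hs := card_sqrt_neg_one h2 hε hmod
  have hpos : 1 ≤ Nat.card F := Nat.card_pos
  have key := congrArg (Nat.cast : ℕ → ℤ) (h.symm.trans hc)
  push_cast [hpos] at key
  rw [hs, Nat.card_eq_fintype_card (α := F)] at key
  refine key.trans ?_
  ring
end

section
/- Let q be an odd prime power. Then the number of involutions of PGL_2(q) is exactly q². -/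
open Matrix

theorem mk_eq_mk_iff_exists_smul {F : Type*} [Field F] (g h : GL (Fin 2) F) :
    (g : PGL2 F) = h ↔ ∃ r : F, h.val = r • g.val := by
  rw [QuotientGroup.eq, GeneralLinearGroup.mem_center_iff_val_mem_range_scalar]
  refine exists_congr fun r ↦ ?_
  rw [Units.val_mul, eq_comm, Units.inv_mul_eq_iff_eq_mul, scalar_apply,
    ← smul_eq_mul_diagonal]

theorem mem_center_GL_two_iff {F : Type*} [Field F] (g : GL (Fin 2) F) :
    g ∈ Subgroup.center (GL (Fin 2) F) ↔ g 0 1 = 0 ∧ g 1 0 = 0 ∧ g 0 0 = g 1 1 := by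
  rw [GeneralLinearGroup.mem_center_iff_val_mem_range_scalar]
  constructor
  · rintro ⟨r, hr⟩
    simp [← hr]
  · rintro ⟨hb, hc, had⟩
    refine ⟨g 0 0, ?_⟩
    ext i j
    fin_cases i <;> fin_cases j <;> simp [hb, hc, had]

theorem orderOf_mk_eq_two_iff_trace_eq_zero {F : Type*} [Field F] (hF : (2 : F) ≠ 0)
    (g : GL (Fin 2) F) : orderOf (g : PGL2 F) = 2 ↔ g.val.trace = 0 := by
  have hdet : g 0 0 * g 1 1 - g 0 1 * g 1 0 ≠ 0 := by
    rw [← det_fin_two]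
    exact g.det_ne_zero
  rw [orderOf_eq_prime_iff, ← QuotientGroup.mk_pow, Ne, QuotientGroup.eq_one_iff,
    QuotientGroup.eq_one_iff, mem_center_GL_two_iff, mem_center_GL_two_iff, trace_fin_two]
  simp only [pow_two, Units.val_mul, mul_apply, Fin.sum_univ_two]
  constructor
  · rintro ⟨⟨hb, hc, had⟩, hg⟩
    by_contra htr
    exact hg ⟨mul_left_cancel₀ htr (by linear_combination hb),
      mul_left_cancel₀ htr (by linear_combination hc),
      mul_left_cancel₀ htr (by linear_combination had)⟩
  · intro htr
    refine ⟨⟨by linear_combination g 0 1 * htr, by linear_combination g 1 0 * htr,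
      by linear_combination (g 0 0 - g 1 1) * htr⟩, ?_⟩
    rintro ⟨hb, hc, had⟩
    have ha : g 1 1 = 0 := mul_left_cancel₀ hF (by linear_combination htr - had)
    exact hdet (by simp [ha, hb])

open scoped Classical in
/-- Representatives of the traceless invertible `2 × 2` matrices up to scaling: for `d ≠ 0` the
matrix of determinant `-d` with lower row `(1, -a)`, and for `d = 0` an upper triangular one. -/
noncomputable def tracelessRep {F : Type*} [Field F] (x : F × F) : GL (Fin 2) F :=
  if h : x.2 = 0 then GeneralLinearGroup.mkOfDetNeZero !![1, x.1; 0, -1] (by simp)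
  else GeneralLinearGroup.mkOfDetNeZero !![x.1, x.2 - x.1 ^ 2; 1, -x.1] (by
    rw [det_fin_two_of]
    contrapose! h
    linear_combination -h)

theorem tracelessRep_zero {F : Type*} [Field F] (a : F) :
    (tracelessRep (a, 0)).val = !![1, a; 0, -1] := by
  simp [tracelessRep, GeneralLinearGroup.mkOfDetNeZero]

theorem tracelessRep_of_ne_zero {F : Type*} [Field F] (a : F) {d : F} (hd : d ≠ 0) :
    (tracelessRep (a, d)).val = !![a, d - a ^ 2; 1, -a] := by
  simp [tracelessRep, GeneralLinearGroup.mkOfDetNeZero, hd]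

theorem trace_tracelessRep {F : Type*} [Field F] (x : F × F) :
    (tracelessRep x).val.trace = 0 := by
  obtain ⟨a, d⟩ := x
  by_cases hd : d = 0
  · subst hd
    simp [tracelessRep_zero, trace_fin_two]
  · simp [tracelessRep_of_ne_zero a hd, trace_fin_two]

theorem mk_tracelessRep_injective {F : Type*} [Field F] :
    Function.Injective fun x : F × F ↦ (tracelessRep x : PGL2 F) := by
  rintro ⟨a, d⟩ ⟨a', d'⟩ h
  obtain ⟨r, hr⟩ := (mk_eq_mk_iff_exists_smul _ _).mp h
  have h00 := congr_fun₂ hr 0 0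
  have h01 := congr_fun₂ hr 0 1
  have h10 := congr_fun₂ hr 1 0
  by_cases hd : d = 0 <;> by_cases hd' : d' = 0
  · subst hd hd'
    simp [tracelessRep_zero] at h00 h01
    simp [h01, ← h00]
  · subst hd
    simp [tracelessRep_zero, tracelessRep_of_ne_zero a' hd'] at h10
  · subst hd'
    simp [tracelessRep_zero, tracelessRep_of_ne_zero a hd] at h00 h10
    simp [← h10] at h00
  · simp [tracelessRep_of_ne_zero a hd, tracelessRep_of_ne_zero a' hd'] at h00 h01 h10
    subst h10
    rw [one_mul] at h00
    subst h00
    simpa [eq_comm] using h01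

theorem exists_mk_tracelessRep_eq {F : Type*} [Field F] (g : GL (Fin 2) F)
    (hg : g.val.trace = 0) : ∃ x : F × F, (tracelessRep x : PGL2 F) = g := by
  have hdet : g 0 0 * g 1 1 - g 0 1 * g 1 0 ≠ 0 := by
    rw [← det_fin_two]
    exact g.det_ne_zero
  rw [trace_fin_two, add_eq_zero_iff_neg_eq] at hg
  rw [← hg] at hdet
  simp only [mk_eq_mk_iff_exists_smul]
  by_cases hc : g 1 0 = 0
  · have ha : g 0 0 ≠ 0 := by
      rintro ha
      simp [ha, hc] at hdet
    refine ⟨(g 0 1 / g 0 0, 0), g 0 0, ?_⟩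
    rw [tracelessRep_zero]
    ext i j
    fin_cases i <;> fin_cases j <;> simp [hc, ← hg, mul_div_cancel₀, ha]
  · have hd : (g 0 0 ^ 2 + g 0 1 * g 1 0) / g 1 0 ^ 2 ≠ 0 :=
      div_ne_zero (fun h ↦ hdet (by linear_combination -h)) (pow_ne_zero 2 hc)
    refine ⟨(g 0 0 / g 1 0, (g 0 0 ^ 2 + g 0 1 * g 1 0) / g 1 0 ^ 2), g 1 0, ?_⟩
    rw [tracelessRep_of_ne_zero _ hd]
    ext i j
    fin_cases i <;> fin_cases j <;> simp [← hg] <;> field_simp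
    ring

/-- For an odd prime power `q`, the number of involutions of `PGL₂(q)` is exactly `q²`. -/
theorem card_involutions_PGL2 (q : ℕ) (hq : IsPrimePow q) (hodd : Odd q)
    (F : Type*) [Field F] [Fintype F] (hF : Fintype.card F = q) :
    Nat.card {t : PGL2 F // orderOf t = 2} = q ^ 2 := by
  have h2 : (2 : F) ≠ 0 := Ring.two_ne_zero fun h ↦ by
    rw [← hF, ← Nat.not_even_iff_odd, Nat.even_iff] at hodd
    exact hodd (FiniteField.even_card_of_char_two h)
  let f : F × F → {t : PGL2 F // orderOf t = 2} := fun x ↦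
    ⟨tracelessRep x, (orderOf_mk_eq_two_iff_trace_eq_zero h2 _).mpr (trace_tracelessRep x)⟩
  have hf : Function.Bijective f := by
    refine ⟨fun x y h ↦ mk_tracelessRep_injective (congr_arg Subtype.val h), ?_⟩
    rintro ⟨t, ht⟩
    induction t using QuotientGroup.induction_on with
    | H g =>
      obtain ⟨x, hx⟩ :=
        exists_mk_tracelessRep_eq g ((orderOf_mk_eq_two_iff_trace_eq_zero h2 g).mp ht)
      exact ⟨x, Subtype.ext hx⟩
  rw [← Nat.card_eq_of_bijective f hf, Nat.card_prod, Nat.card_eq_fintype_card, hF, pow_two]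
end

section
/- Let q be an odd prime power and let ε ∈ {1,-1} be such that q ≡ ε (mod 4). Then every involution t of PGL_2(q) that does not lie in the subgroup PSL_2(q) is contained in exactly (q+ε)/2 Klein four-subgroups of PGL_2(q). -/
/-- The subgroup `{1, t, x, t * x}` generated by commuting involutions `t` and `x`. -/
def involutionPair {G : Type*} [Group G] (t x : G) (ht : t * t = 1) (hx : x * x = 1)
    (htx : t * x * (t * x) = 1) : Subgroup G where
  carrier := {1, t, x, t * x}
  one_mem' := by simp
  mul_mem' := by
    have h : x * t = t * x := by
      have h1 := eq_inv_of_mul_eq_one_left htx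
      rw [mul_inv_rev, ← eq_inv_of_mul_eq_one_left ht, ← eq_inv_of_mul_eq_one_left hx] at h1
      exact h1.symm
    have h2 : x * (t * x) = t := by rw [← mul_assoc, h, mul_assoc, hx, mul_one]
    have h3 : t * (t * x) = x := by rw [← mul_assoc, ht, one_mul]
    have h4 : t * x * t = x := by rw [mul_assoc, h, h3]
    have h5 : t * x * x = t := by rw [mul_assoc, hx, mul_one]
    rintro a b (rfl | rfl | rfl | rfl) (rfl | rfl | rfl | rfl) <;> simp [*]
  inv_mem' := by
    have h1 := (eq_inv_of_mul_eq_one_left htx).symm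
    have h2 := (eq_inv_of_mul_eq_one_left ht).symm
    have h3 := (eq_inv_of_mul_eq_one_left hx).symm
    rintro a (rfl | rfl | rfl | rfl)
    · simp
    · rw [h2]; simp
    · rw [h3]; simp
    · rw [h1]; simp

theorem orderOf_eq_two_iff_mul_self {G : Type*} [Group G] {x : G} :
    orderOf x = 2 ↔ x * x = 1 ∧ x ≠ 1 := by
  rw [orderOf_eq_iff two_pos]
  refine ⟨fun h ↦ ⟨by simpa [sq] using h.1, by simpa using h.2 1⟩, fun h ↦
    ⟨by simpa [sq] using h.1, fun m hm hm' ↦ ?_⟩⟩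
  obtain rfl : m = 1 := by omega
  simpa using h.2

theorem isKleinFour_involutionPair {G : Type*} [Group G] {t x : G} (ht : orderOf t = 2)
    (hx : orderOf x = 2) (htx : orderOf (t * x) = 2) :
    IsKleinFour (involutionPair t x (orderOf_eq_two_iff_mul_self.1 ht).1
      (orderOf_eq_two_iff_mul_self.1 hx).1 (orderOf_eq_two_iff_mul_self.1 htx).1) := by
  rw [orderOf_eq_two_iff_mul_self] at ht hx htx
  have hne : t ≠ x := by rintro rfl; exact htx.2 ht.1
  constructor
  · change Nat.card ({1, t, x, t * x} : Set G) = 4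
    rw [Nat.card_coe_set_eq]
    have h1 : x ≠ t * x := fun h ↦ ht.2 (by simpa using h)
    have h2 : t ≠ t * x := fun h ↦ hx.2 (by simpa using h)
    rw [Set.ncard_insert_of_notMem, Set.ncard_insert_of_notMem, Set.ncard_pair h1]
    · simp [hne, h2]
    · simp [ht.2.symm, hx.2.symm, htx.2.symm]
  · have : Nontrivial (involutionPair t x ht.1 hx.1 htx.1) :=
      ⟨⟨⟨t, by simp [involutionPair]⟩, 1, fun h ↦ ht.2 (congrArg Subtype.val h)⟩⟩
    refine (Monoid.exponent_eq_prime_iff Nat.prime_two).2 ?_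
    rintro ⟨y, hy⟩ hy1
    refine orderOf_eq_two_iff_mul_self.2 ⟨Subtype.ext ?_, hy1⟩
    rcases hy with rfl | rfl | rfl | rfl
    exacts [one_mul 1, ht.1, hx.1, htx.1]

theorem two_mul_card_isKleinFour {G : Type*} [Group G] [Finite G] {t : G} (ht : orderOf t = 2) :
    2 * Nat.card {H : Subgroup G // IsKleinFour H ∧ t ∈ H} =
      {x : G | orderOf x = 2 ∧ orderOf (t * x) = 2}.ncard := by
  classical
  have := Fintype.ofFinite G
  have := Fintype.ofFinite (Subgroup G)
  have ht' := orderOf_eq_two_iff_mul_self.1 ht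
  rw [Nat.card_eq_fintype_card, Fintype.card_subtype, Set.ncard_eq_toFinset_card', mul_comm]
  refine (Finset.card_mul_eq_card_mul (fun (H : Subgroup G) x ↦ x ∈ H) (m := 2) (n := 1)
    (fun H hH ↦ ?_) (fun x hx ↦ ?_)).trans (mul_one _)
  · simp only [Finset.mem_filter, Finset.mem_univ, true_and] at hH
    obtain ⟨hK, htH⟩ := hH
    rw [Finset.bipartiteAbove, ← Set.ncard_coe_finset]
    have : ((Finset.filter (fun x ↦ x ∈ H)
        {x : G | orderOf x = 2 ∧ orderOf (t * x) = 2}.toFinset : Finset G) : Set G) =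
        (H : Set G) \ {1, t} := by
      ext x
      have hmul : ∀ y ∈ H, y * y = 1 := fun y hy ↦
        congrArg Subtype.val (IsKleinFour.mul_self (⟨y, hy⟩ : H))
      simp only [Finset.coe_filter, Set.mem_toFinset, Set.mem_ofPred_eq, Set.mem_sdiff,
        SetLike.mem_coe, Set.mem_insert_iff, Set.mem_singleton_iff, not_or,
        orderOf_eq_two_iff_mul_self]
      constructor
      · rintro ⟨⟨⟨h1, h2⟩, h3, h4⟩, h5⟩
        exact ⟨h5, h2, by rintro rfl; exact h4 h1⟩
      · rintro ⟨h1, h2, h3⟩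
        refine ⟨⟨⟨hmul x h1, h2⟩, hmul _ (H.mul_mem htH h1), fun h ↦ h3 ?_⟩, h1⟩
        rw [← mul_right_inj t, h, ht'.1]
    rw [this, Set.ncard_sdiff (by simp [Set.insert_subset_iff, H.one_mem, htH]),
      Set.ncard_pair ht'.2.symm]
    have := hK.card_four
    rw [← SetLike.coe_sort_coe, Nat.card_coe_set_eq] at this
    rw [this]
  · simp only [Set.mem_toFinset, Set.mem_ofPred_eq] at hx
    have hx1 := orderOf_eq_two_iff_mul_self.1 hx.1
    have hx2 := orderOf_eq_two_iff_mul_self.1 hx.2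
    have hK := isKleinFour_involutionPair ht hx.1 hx.2
    rw [Finset.card_eq_one]
    refine ⟨involutionPair t x ht'.1 hx1.1 hx2.1, ?_⟩
    ext H
    simp only [Finset.mem_bipartiteBelow, Finset.mem_filter, Finset.mem_univ, true_and,
      Finset.mem_singleton]
    constructor
    · rintro ⟨⟨hH, htH⟩, hxH⟩
      symm
      refine Subgroup.eq_of_le_of_card_ge ?_ (by rw [hK.card_four, hH.card_four])
      rintro y (rfl | rfl | rfl | rfl)
      exacts [H.one_mem, htH, hxH, H.mul_mem htH hxH]
    · rintro rfl
      exact ⟨⟨hK, by simp [involutionPair]⟩, by simp [involutionPair]⟩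

theorem nonempty_mulEquiv_iff_isKleinFour {G : Type*} [Group G] :
    Nonempty (G ≃* Multiplicative (ZMod 2 × ZMod 2)) ↔ IsKleinFour G := by
  refine ⟨fun ⟨e⟩ ↦ ⟨?_, ?_⟩, fun h ↦ IsKleinFour.nonempty_mulEquiv⟩
  · rw [Nat.card_congr e.toEquiv, IsKleinFour.card_four]
  · rw [Monoid.exponent_eq_of_mulEquiv e, IsKleinFour.exponent_two]

section

open Matrix

theorem mul_self_of_trace_eq_zero {F : Type*} [Field F]
    {A : Matrix (Fin 2) (Fin 2) F} (hA : A.trace = 0) : A * A = -A.det • 1 := by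
  simp only [trace_fin_two] at hA
  ext i j
  fin_cases i <;> fin_cases j <;> simp [mul_apply, Fin.sum_univ_two, det_fin_two]
  · linear_combination A 0 0 * hA
  · linear_combination A 0 1 * hA
  · linear_combination A 1 0 * hA
  · linear_combination A 1 1 * hA

theorem PGL2.mk_eq_mk_iff {F : Type*} [Field F] {g h : GL (Fin 2) F} :
    (g : PGL2 F) = h ↔ ∃ c : F, h.val = c • g.val := by
  rw [QuotientGroup.eq, GeneralLinearGroup.mem_center_iff_val_mem_range_scalar]
  refine exists_congr fun c ↦ ?_
  rw [Units.val_mul, scalar_apply, ← smul_one_eq_diagonal, eq_comm, Units.inv_mul_eq_iff_eq_mul,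
    Matrix.mul_smul, mul_one]

theorem PGL2.orderOf_mk_eq_two_iff {F : Type*} [Field F] (h2 : (2 : F) ≠ 0)
    {g : GL (Fin 2) F} : orderOf (g : PGL2 F) = 2 ↔ g.val.trace = 0 := by
  have hd : g.val.det ≠ 0 := g.det_ne_zero
  have one_iff : (g : PGL2 F) = 1 ↔ ∃ c : F, g.val = c • 1 := by
    rw [eq_comm, ← QuotientGroup.mk_one, PGL2.mk_eq_mk_iff, Units.val_one]
  have sq_iff : (g : PGL2 F) * g = 1 ↔ ∃ c : F, g.val * g.val = c • 1 := by
    rw [eq_comm, ← QuotientGroup.mk_one, ← QuotientGroup.mk_mul, PGL2.mk_eq_mk_iff, Units.val_one,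
      Units.val_mul]
  rw [orderOf_eq_two_iff_mul_self, sq_iff, ne_eq, one_iff]
  refine ⟨fun ⟨⟨c, hc⟩, hn⟩ ↦ ?_, fun h ↦ ⟨⟨_, mul_self_of_trace_eq_zero h⟩, ?_⟩⟩
  · by_contra ht
    rw [trace_fin_two] at ht
    have e := congrFun₂ hc
    have e00 := e 0 0
    have e01 := e 0 1
    have e10 := e 1 0
    have e11 := e 1 1
    simp [mul_apply, Fin.sum_univ_two] at e00 e01 e10 e11
    have hb : g.val 0 1 = 0 := by
      refine (mul_eq_zero.1 ?_).resolve_right ht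
      linear_combination e01
    have hc : g.val 1 0 = 0 := by
      refine (mul_eq_zero.1 ?_).resolve_right ht
      linear_combination e10
    have hd : g.val 0 0 - g.val 1 1 = 0 := by
      refine (mul_eq_zero.1 ?_).resolve_right ht
      linear_combination e00 - e11
    refine hn ⟨g.val 0 0, ?_⟩
    ext i j
    fin_cases i <;> fin_cases j <;> simp [hb, hc]
    linear_combination -hd
  · rintro ⟨c, hc⟩
    rw [hc] at h hd
    simp only [trace_smul, trace_one, Fintype.card_fin, smul_eq_mul, Nat.cast_ofNat,
      mul_eq_zero, h2, or_false] at h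
    simp [h] at hd

theorem PGL2.not_isSquare_det {F : Type*} [Field F] {g : GL (Fin 2) F}
    (hg : (g : PGL2 F) ∉ PSL2 F) : ¬ IsSquare g.val.det := by
  rintro ⟨s, hs⟩
  have hd : g.val.det ≠ 0 := g.det_ne_zero
  have hs0 : s ≠ 0 := by rintro rfl; simp [hs] at hd
  have hdet : (s⁻¹ • g.val).det = 1 := by
    rw [det_smul, hs, Fintype.card_fin, ← sq, ← mul_pow, inv_mul_cancel₀ hs0, one_pow]
  exact hg ⟨⟨s⁻¹ • g.val, hdet⟩, PGL2.mk_eq_mk_iff.2 ⟨s, (smul_inv_smul₀ hs0 g.val).symm⟩⟩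

/-- If `A` is a traceless `2 × 2` matrix, some invertible matrix `B` has both `B` and `A * B`
traceless. -/
theorem exists_trace_eq_zero_trace_mul_eq_zero {F : Type*} [Field F]
    {A : Matrix (Fin 2) (Fin 2) F} (hA : A.trace = 0) :
    ∃ B : Matrix (Fin 2) (Fin 2) F, B.det ≠ 0 ∧ B.trace = 0 ∧ (A * B).trace = 0 := by
  have hA' : A 1 1 = - A 0 0 := by
    rw [trace_fin_two] at hA; linear_combination hA
  simp only [trace_fin_two, det_fin_two, mul_apply, Fin.sum_univ_two, hA']
  by_cases hb : A 0 1 = 0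
  · by_cases hc : A 1 0 = 0
    · exact ⟨!![0, 1; 1, 0], by simp, by simp, by simp [hb, hc]⟩
    · refine ⟨!![-A 1 0, 2 * A 0 0; 0, A 1 0], by simp [hc], by simp, ?_⟩
      simp; ring
  · refine ⟨!![-A 0 1, 0; 2 * A 0 0, A 0 1], by simp [hb], by simp, ?_⟩
    simp; ring

theorem exists_eq_smul_one_add_smul_of_commute {F : Type*} [Field F]
    {A M : Matrix (Fin 2) (Fin 2) F} (hA : ∀ c : F, A ≠ c • 1) (h : Commute A M) :
    ∃ u v : F, M = u • 1 + v • A := by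
  have e := congrFun₂ h.eq
  have e00 := e 0 0
  have e01 := e 0 1
  have e10 := e 1 0
  have e11 := e 1 1
  simp only [mul_apply, Fin.sum_univ_two] at e00 e01 e10 e11
  have key : ∀ v : F, A 0 1 * v = M 0 1 → A 1 0 * v = M 1 0 →
      (A 0 0 - A 1 1) * v = M 0 0 - M 1 1 → ∃ u v : F, M = u • 1 + v • A := by
    intro v h1 h2 h3
    refine ⟨M 0 0 - v * A 0 0, v, ?_⟩
    ext i j
    fin_cases i <;> fin_cases j <;> simp
    · linear_combination -h1
    · linear_combination -h2
    · linear_combination h3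
  by_cases hb : A 0 1 = 0
  · by_cases hc : A 1 0 = 0
    · have hd : A 0 0 - A 1 1 ≠ 0 := by
        intro hd
        apply hA (A 0 0)
        ext i j
        fin_cases i <;> fin_cases j <;> simp [hb, hc]
        linear_combination -hd
      refine key ((M 0 0 - M 1 1) / (A 0 0 - A 1 1)) ?_ ?_ ?_ <;> field_simp
      · linear_combination -e01
      · linear_combination e10
    · refine key (M 1 0 / A 1 0) ?_ ?_ ?_ <;> field_simp
      · linear_combination e00
      · linear_combination -e10
  · refine key (M 0 1 / A 0 1) ?_ ?_ ?_ <;> field_simp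
    · linear_combination -e00
    · linear_combination e01

theorem det_smul_one_add_smul {F : Type*} [Field F]
    {A : Matrix (Fin 2) (Fin 2) F} (hA : A.trace = 0) (u v : F) :
    (u • 1 + v • A).det = u ^ 2 + v ^ 2 * A.det := by
  rw [trace_fin_two] at hA
  simp [det_fin_two]
  linear_combination u * v * hA

theorem mul_eq_neg_mul_of_trace_eq_zero {F : Type*} [Field F]
    {A B : Matrix (Fin 2) (Fin 2) F} (hA : A.trace = 0) (hB : B.trace = 0)
    (hAB : (A * B).trace = 0) : A * B = -(B * A) := by
  simp only [trace_fin_two, mul_apply, Fin.sum_univ_two] at hA hB hAB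
  ext i j
  fin_cases i <;> fin_cases j <;> simp [mul_apply, Fin.sum_univ_two]
  · linear_combination hAB + A 0 0 * hB - B 1 1 * hA
  · linear_combination A 0 1 * hB + B 0 1 * hA
  · linear_combination A 1 0 * hB + B 1 0 * hA
  · linear_combination hAB - A 0 0 * hB + B 1 1 * hA

theorem card_one_add_sq_mul_ne_zero {F : Type*} [Field F] [Fintype F] (h2 : ringChar F ≠ 2)
   {ε : ℤ} (hε : ε = 1 ∨ ε = -1) (hmod : (Fintype.card F : ℤ) ≡ ε [ZMOD 4]) {d : F}
    (hd : ¬ IsSquare d) : (Nat.card {v : F // 1 + v ^ 2 * d ≠ 0} : ℤ) = Fintype.card F + ε - 1 := by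
  classical
  have hd0 : d ≠ 0 := by rintro rfl; simp at hd
  have h1 : quadraticChar F (-1) = ε := by
    rw [quadraticChar_neg_one h2]
    rcases hε with rfl | rfl
    · exact ZMod.χ₄_nat_one_mod_four (by have := hmod; unfold Int.ModEq at this; omega)
    · exact ZMod.χ₄_nat_three_mod_four (by have := hmod; unfold Int.ModEq at this; omega)
  have h3 := quadraticChar_card_sqrts h2 (-d⁻¹)
  rw [neg_eq_neg_one_mul, map_mul, h1,
    quadraticChar_neg_one_iff_not_isSquare.2 (by rwa [isSquare_inv])] at h3
  have h4 := Fintype.card_subtype_compl (fun v : F ↦ 1 + v ^ 2 * d = 0)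
  have h5 := Fintype.card_subtype_le (fun v : F ↦ 1 + v ^ 2 * d = 0)
  rw [Nat.card_eq_fintype_card]
  have h6 : {x : F | x ^ 2 = -1 * d⁻¹}.toFinset.card =
      Fintype.card {v : F // 1 + v ^ 2 * d = 0} := by
    rw [Set.toFinset_card]
    refine Fintype.card_congr (Equiv.subtypeEquivRight fun v ↦ ?_)
    simp only [Set.mem_ofPred_eq]
    rw [← div_eq_mul_inv, eq_div_iff hd0]
    constructor <;> intro h <;> linear_combination h
  simp only [ne_eq]
  omega

theorem PGL2.ne_smul_one_of_trace_eq_zero {F : Type*} [Field F] (h2 : (2 : F) ≠ 0)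
    {g : GL (Fin 2) F} (hg : g.val.trace = 0) (a : F) : g.val ≠ a • 1 := by
  intro ha
  have := (orderOf_eq_two_iff_mul_self.1 ((PGL2.orderOf_mk_eq_two_iff h2).2 hg)).2
  rw [ne_eq, eq_comm, ← QuotientGroup.mk_one, PGL2.mk_eq_mk_iff] at this
  exact this ⟨a, ha⟩

/-- The elements `x` such that `x` and `g * x` are both involutions form a coset of the image in
`PGL₂(F)` of the torus `F[g]ˣ`. -/
theorem PGL2.orderOf_eq_two_and_iff {F : Type*} [Field F] (h2 : (2 : F) ≠ 0) {g b : GL (Fin 2) F}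
    (hg : g.val.trace = 0) (hb : b.val.trace = 0) (hgb : (g.val * b.val).trace = 0) (x : PGL2 F) :
    (orderOf x = 2 ∧ orderOf ((g : PGL2 F) * x) = 2) ↔
      ∃ (m : GL (Fin 2) F) (u v : F), m.val = u • 1 + v • g.val ∧ x = b * m := by
  have hgb' := mul_eq_neg_mul_of_trace_eq_zero hg hb hgb
  constructor
  · induction x using QuotientGroup.induction_on with | _ c => ?_
    rw [← QuotientGroup.mk_mul, PGL2.orderOf_mk_eq_two_iff h2, PGL2.orderOf_mk_eq_two_iff h2,
      Units.val_mul]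
    rintro ⟨hc, hgc⟩
    have hgc' := mul_eq_neg_mul_of_trace_eq_zero hg hc hgc
    have hcomm : Commute g.val (b⁻¹ * c).val := by
      change g.val * _ = _
      rw [← Units.mul_right_inj b, ← mul_assoc, ← neg_inj, ← neg_mul, ← hgb']
      simp only [Units.val_mul, mul_assoc, Units.mul_inv_cancel_left]
      rw [hgc']
    have hns : ∀ a : F, g.val ≠ a • 1 := PGL2.ne_smul_one_of_trace_eq_zero h2 hg
    obtain ⟨u, v, h⟩ := exists_eq_smul_one_add_smul_of_commute hns hcomm
    exact ⟨b⁻¹ * c, u, v, h, by simp [← QuotientGroup.mk_mul]⟩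
  · rintro ⟨m, u, v, hm, rfl⟩
    rw [← QuotientGroup.mk_mul, ← QuotientGroup.mk_mul, PGL2.orderOf_mk_eq_two_iff h2,
      PGL2.orderOf_mk_eq_two_iff h2]
    simp only [Units.val_mul, hm, mul_add, Matrix.mul_smul, mul_one, trace_add, trace_smul, hb,
      hgb, trace_mul_comm b.val]
    rw [trace_mul_comm g.val (b.val * g.val), mul_assoc, mul_self_of_trace_eq_zero hg]
    simp [hb]

theorem PGL2.ncard_orderOf_eq_two {F : Type*} [Field F] [Fintype F] (h2 : (2 : F) ≠ 0)
    {g : GL (Fin 2) F} (hg : g.val.trace = 0) :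
    {x : PGL2 F | orderOf x = 2 ∧ orderOf ((g : PGL2 F) * x) = 2}.ncard =
      Nat.card {v : F // 1 + v ^ 2 * g.val.det ≠ 0} + 1 := by
  obtain ⟨B, hB, htB, hgB⟩ := exists_trace_eq_zero_trace_mul_eq_zero hg
  obtain ⟨b, rfl⟩ : ∃ b : GL (Fin 2) F, b.val = B := ⟨.mkOfDetNeZero B hB, rfl⟩
  have hdet (v : F) : ((1 : F) • 1 + v • g.val).det = 1 + v ^ 2 * g.val.det := by
    rw [det_smul_one_add_smul hg, one_pow]
  let m (v : {v : F // 1 + v ^ 2 * g.val.det ≠ 0}) : GL (Fin 2) F :=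
    .mkOfDetNeZero ((1 : F) • 1 + v.1 • g.val) (by rw [hdet]; exact v.2)
  have hm (v) : (m v).val = (1 : F) • 1 + v.1 • g.val := rfl
  have hns : ∀ a : F, g.val ≠ a • 1 := PGL2.ne_smul_one_of_trace_eq_zero h2 hg
  have hli (u v : F) (h : u • (1 : Matrix (Fin 2) (Fin 2) F) + v • g.val = 0) :
      u = 0 ∧ v = 0 := by
    have hv : v = 0 := by
      by_contra hv
      refine hns (-(v⁻¹ * u)) ?_
      rw [← inv_smul_smul₀ hv g.val, eq_neg_of_add_eq_zero_right h, smul_neg, smul_smul, neg_smul]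
    subst hv
    simpa using h
  have hset : {x : PGL2 F | orderOf x = 2 ∧ orderOf ((g : PGL2 F) * x) = 2} =
      insert ((b : PGL2 F) * g) (Set.range fun v ↦ (b : PGL2 F) * m v) := by
    ext x
    rw [Set.mem_ofPred_eq, PGL2.orderOf_eq_two_and_iff h2 hg htB hgB, Set.mem_insert_iff,
      Set.mem_range]
    constructor
    · rintro ⟨c, u, v, hc, rfl⟩
      simp only [mul_right_inj]
      by_cases hu : u = 0
      · left
        rw [eq_comm, PGL2.mk_eq_mk_iff]
        exact ⟨v, by simp [hc, hu]⟩
      · right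
        have hc' : c.val = u • ((1 : F) • 1 + (v / u) • g.val) := by
          rw [hc, smul_add, smul_smul, smul_smul, mul_one, mul_div_cancel₀ _ hu]
        have hcd : c.val.det ≠ 0 := c.det_ne_zero
        rw [hc', det_smul, hdet] at hcd
        refine ⟨⟨v / u, right_ne_zero_of_mul hcd⟩, PGL2.mk_eq_mk_iff.2 ⟨u, hc'⟩⟩
    · rintro (rfl | ⟨v, rfl⟩)
      · exact ⟨g, 0, 1, by simp, rfl⟩
      · exact ⟨m v, 1, v, hm v, rfl⟩
  rw [hset, Set.ncard_insert_of_notMem, ← Set.image_univ, Set.ncard_image_of_injective,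
    Set.ncard_univ]
  · intro v w h
    obtain ⟨c, hc⟩ := PGL2.mk_eq_mk_iff.1 (mul_left_cancel h)
    rw [hm, hm] at hc
    obtain ⟨h1, h2⟩ := hli (1 - c) (w - c * v) (by
      rw [← sub_eq_zero] at hc
      rw [← hc]
      module)
    obtain rfl : c = 1 := by linear_combination -h1
    exact Subtype.ext (by linear_combination -h2)
  · rintro ⟨v, h⟩
    obtain ⟨c, hc⟩ := PGL2.mk_eq_mk_iff.1 (mul_left_cancel h)
    rw [hm] at hc
    obtain ⟨h1, h2⟩ := hli c (c * v - 1) (by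
      rw [eq_comm, ← sub_eq_zero] at hc
      rw [← hc]
      module)
    simp [h1] at h2

end

/-- For an odd prime power `q` with `q ≡ ε (mod 4)`, `ε = ±1`, every involution of
`PGL₂(q)` not lying in `PSL₂(q)` is contained in exactly `(q+ε)/2` Klein
four-subgroups of `PGL₂(q)`. -/
theorem card_klein_four_above_outer_involution (q : ℕ) (hq : IsPrimePow q) (hodd : Odd q)
    (ε : ℤ) (hε : ε = 1 ∨ ε = -1) (hmod : (q : ℤ) ≡ ε [ZMOD 4])
    (F : Type*) [Field F] [Fintype F] (hF : Fintype.card F = q)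
    (t : PGL2 F) (ht : orderOf t = 2) (htn : t ∉ PSL2 F) :
    2 * (Nat.card {H : Subgroup (PGL2 F) //
        Nonempty (H ≃* Multiplicative (ZMod 2 × ZMod 2)) ∧ t ∈ H} : ℤ) = q + ε := by
  subst hF
  have h2 : ringChar F ≠ 2 := fun h ↦ by
    rw [FiniteField.even_card_iff_char_two] at h
    rw [Nat.odd_iff] at hodd
    omega
  induction t using QuotientGroup.induction_on with | _ g => ?_
  have h2' : (2 : F) ≠ 0 := Ring.two_ne_zero h2
  have hg := (PGL2.orderOf_mk_eq_two_iff h2').1 ht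
  have hcard := two_mul_card_isKleinFour ht
  rw [PGL2.ncard_orderOf_eq_two h2' hg] at hcard
  have hcount := card_one_add_sq_mul_ne_zero h2 hε hmod (PGL2.not_isSquare_det htn)
  simp only [nonempty_mulEquiv_iff_isKleinFour]
  zify at hcard
  rw [hcard, hcount]
  ring
end
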